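/- arXiv:1208.5120 — 3 statements merged into one kernel-verified Lean document; each statement's English description precedes it below -/
import Mathlib

section
/- Let e and f be projections in an AW*-algebra A. Then there exist pairwise orthogonal central projections x, y, z in A with x + y + z = 1 such that xe ≺ xf, ye ∼ yf, and ze ≻ zf. -/
universe u

section Defs

variable {R : Type u} [Ring R] [StarRing R]

/-- An element is a projection if it is self-adjoint and idempotent. -/
def IsProjection (p : R) : Prop := star p = p ∧ p * p = p

/-- Order on projections: `e ≤ f` iff `e = ef`. -/
def ProjLE (e f : R) : Prop := e * f = e

/-- Murray–von Neumann equivalence of projections. -/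
def ProjEquiv (e f : R) : Prop := ∃ v : R, star v * v = e ∧ v * star v = f

/-- `e ≼ f` : `e` is equivalent to a subprojection of `f`. -/
def ProjSubEquiv (e f : R) : Prop :=
  ∃ e' : R, IsProjection e' ∧ ProjLE e' f ∧ ProjEquiv e e'

/-- `e ≺ f` : `e ≼ f` but `e` is not equivalent to `f` (with the convention `0 ≺ 0`). -/
def ProjLT (e f : R) : Prop :=
  (ProjSubEquiv e f ∧ ¬ ProjEquiv e f) ∨ (e = 0 ∧ f = 0)

/-- A central projection. -/
def IsCentralProj (z : R) : Prop := IsProjection z ∧ ∀ a : R, z * a = a * z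

/-- `c` is the central cover of `e`: the least central projection above `e`. -/
def IsCentralCover (e c : R) : Prop :=
  IsCentralProj c ∧ ProjLE e c ∧
    ∀ z : R, IsCentralProj z → ProjLE e z → ProjLE c z

/-- A projection `e` is finite if `e ∼ f ≤ e` implies `f = e`. -/
def ProjFinite (e : R) : Prop :=
  ∀ f : R, IsProjection f → ProjEquiv e f → ProjLE f e → f = e

/-- A nonzero projection is properly infinite if `ze` is infinite
for every central projection `z` with `ze ≠ 0`. -/
def ProperlyInfinite (e : R) : Prop :=
  IsProjection e ∧ e ≠ 0 ∧
    ∀ z : R, IsCentralProj z → z * e ≠ 0 → ¬ ProjFinite (z * e)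

/-- A pairwise orthogonal family of elements. -/
def PairwiseOrthogonal {ι : Type*} (p : ι → R) : Prop :=
  ∀ i j, i ≠ j → p i * p j = 0

/-- `s` is the supremum of the family `p` in the projection order. For an
orthogonal family, this is the sum `Σ pᵢ`. -/
def IsSupProj {ι : Type*} (p : ι → R) (s : R) : Prop :=
  IsProjection s ∧ (∀ i, ProjLE (p i) s) ∧
    ∀ t : R, IsProjection t → (∀ i, ProjLE (p i) t) → ProjLE s t

/-- The family `p` belongs to `Γ(e)`: an orthogonal family of projections,
each equivalent to `e`, with sum (supremum) `e`. -/
def InGamma (e : R) {ι : Type u} (p : ι → R) : Prop :=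
  (∀ i, IsProjection (p i)) ∧ PairwiseOrthogonal p ∧
    (∀ i, ProjEquiv (p i) e) ∧ IsSupProj p e

open Classical in
/-- The dimension `d(e)` of a properly infinite projection: the least cardinal
strictly greater than the cardinality of the index set of every family in
`Γ(e)`, with the convention `d(0) = 0`. -/
noncomputable def projDim (e : R) : Cardinal.{u} :=
  if e = 0 then 0
  else sSup {c : Cardinal.{u} |
    ∃ (ι : Type u) (p : ι → R), InGamma e p ∧ c = Order.succ (Cardinal.mk ι)}

/-- A properly infinite projection `e` is equidimensional if `d(ze) = d(e)`
for every central projection `z` with `ze ≠ 0` (equivalently, for every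
nonzero central projection `z ≤ c(e)`). -/
def Equidimensional (e : R) : Prop :=
  ProperlyInfinite e ∧
    ∀ z : R, IsCentralProj z → z * e ≠ 0 → projDim (z * e) = projDim e

/-- An abelian projection: the corner `eRe` is commutative. -/
def IsAbelianProj (e : R) : Prop :=
  IsProjection e ∧ ∀ a b : R, (e * a * e) * (e * b * e) = (e * b * e) * (e * a * e)

/-- `j` is the join `e ∨ f` in the projection lattice. -/
def IsJoinProj (e f j : R) : Prop :=
  IsProjection j ∧ ProjLE e j ∧ ProjLE f j ∧
    ∀ t : R, IsProjection t → ProjLE e t → ProjLE f t → ProjLE j t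

end Defs

/-- The AW*-condition: the right annihilator of any subset is generated by a
projection: `{a | ∀ s ∈ S, s a = 0} = pR`. -/
def IsAWStarRing (R : Type*) [Ring R] [StarRing R] : Prop :=
  ∀ S : Set R, ∃ p : R, IsProjection p ∧
    {a : R | ∀ s ∈ S, s * a = 0} = {a : R | ∃ b : R, a = p * b}

/-- A maximal abelian (*-sub)algebra. -/
def IsMaximalAbelian {A : Type*} [Ring A] [StarRing A] [Algebra ℂ A] [StarModule ℂ A]
    (M : StarSubalgebra ℂ A) : Prop :=
  (∀ x ∈ M, ∀ y ∈ M, x * y = y * x) ∧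
    ∀ N : StarSubalgebra ℂ A, (∀ x ∈ N, ∀ y ∈ N, x * y = y * x) → M ≤ N → M = N

theorem aux_star {R : Type u} [Ring R] [StarRing R] {a b c : R} (h : a * b = c) :
    star b * star a = star c := by rw [← star_mul, h]

/-- supports of sets -/
theorem aux_supp {R : Type u} [Ring R] [StarRing R] (hAW : IsAWStarRing R) (S : Set R) :
    ∃ s : R, IsProjection s ∧ ∀ x, s * x = 0 ↔ ∀ t ∈ S, t * x = 0 := by
  obtain ⟨p, ⟨hp1, hp2⟩, hp⟩ := hAW S
  refine ⟨1 - p, ⟨by simp [hp1], by simp [mul_sub, sub_mul, hp2]⟩, fun x => ?_⟩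
  have hx : x ∈ {a : R | ∀ s ∈ S, s * a = 0} ↔ x ∈ {a : R | ∃ b : R, a = p * b} := by rw [hp]
  simp only [Set.mem_setOf_eq] at hx
  rw [hx, sub_mul, one_mul, sub_eq_zero]
  constructor
  · intro h; exact ⟨x, h⟩
  · rintro ⟨b, rfl⟩; rw [← mul_assoc, hp2]

theorem aux_supp_left {R : Type u} [Ring R] [StarRing R] {S : Set R} {s : R}
    (hs : IsProjection s) (h : ∀ x, s * x = 0 ↔ ∀ t ∈ S, t * x = 0)
    (hS : ∀ t ∈ S, star t = t) (x : R) (hx : ∀ t ∈ S, x * t = 0) : x * s = 0 := by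
  have : s * star x = 0 := by
    rw [h]
    intro t ht
    have := aux_star (hx t ht)
    rwa [hS t ht, star_zero] at this
  simpa [hs.1] using aux_star this

theorem aux_supp_mul {R : Type u} [Ring R] [StarRing R] {S : Set R} {s : R}
    (hs : IsProjection s) (h : ∀ x, s * x = 0 ↔ ∀ t ∈ S, t * x = 0)
    {t : R} (ht : t ∈ S) : t * s = t := by
  have h1 : s * (1 - s) = 0 := by rw [mul_sub, mul_one, hs.2, sub_self]
  have := (h _).1 h1 t ht
  rw [mul_sub, mul_one, sub_eq_zero] at this
  exact this.symm

theorem aux_comm {R : Type u} [Ring R] [StarRing R] {s a : R}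
    (hs : IsProjection s) (h : ∀ x, s * x = 0 ↔ a * x = 0) {c : R}
    (h1 : a * c = c * a) (h2 : a * star c = star c * a) : s * c = c * s := by
  have h0 : a * (1 - s) = 0 := (h _).1 (by rw [mul_sub, mul_one, hs.2, sub_self])
  have k1 : s * (c * (1 - s)) = 0 := by
    rw [h, ← mul_assoc, h1, mul_assoc, h0, mul_zero]
  have k2 : s * (star c * (1 - s)) = 0 := by
    rw [h, ← mul_assoc, h2, mul_assoc, h0, mul_zero]
  have k3 := aux_star k2
  simp only [star_mul, star_sub, star_one, star_star, hs.1, star_zero] at k3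
  have e1 : s * c = s * c * s := by
    rw [mul_sub, mul_sub, mul_one, sub_eq_zero] at k1; rw [mul_assoc]; exact k1
  have e2 : c * s = s * c * s := by
    rw [sub_mul, one_mul, sub_mul, sub_eq_zero] at k3; exact k3
  rw [e1, e2]

/-- Additivity -/
theorem aux_add {A : Type u} [Ring A] [StarRing A] (hAW : IsAWStarRing A)
    (e f : A) (he : IsProjection e) (hf : IsProjection f) (hef : e * f = 0)
    (S : Set A) (h1 : ∀ v ∈ S, v * e = v) (h2 : ∀ v ∈ S, f * v = v)
    (h3 : ∀ v ∈ S, v * star v * v = v)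
    (h4 : ∀ v ∈ S, ∀ w ∈ S, v ≠ w → v * star w = 0 ∧ star v * w = 0) :
    ∃ w : A, w * star w * w = w ∧ w * e = w ∧ f * w = w ∧
      (∀ v ∈ S, v * (star w * w) = v) ∧ (∀ v ∈ S, (w * star w) * v = v) := by
  obtain ⟨E, hE, hEs⟩ := aux_supp hAW ((fun v => star v * v) '' S)
  obtain ⟨F, hF, hFs⟩ := aux_supp hAW ((fun v => v * star v) '' S)
  obtain ⟨g, hg, hgs⟩ := aux_supp hAW ((fun v => star v * v + v * star v + v + star v) '' S)
  have hfe : f * e = 0 := by simpa [he.1, hf.1] using aux_star hef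
  have hEl := aux_supp_left hE hEs (by rintro _ ⟨v, hv, rfl⟩; simp)
  have hFl := aux_supp_left hF hFs (by rintro _ ⟨v, hv, rfl⟩; simp)
  have hgl := aux_supp_left hg hgs (by
    rintro _ ⟨v, hv, rfl⟩; simp only [star_add, star_mul, star_star]; abel)
  have h3' : ∀ v ∈ S, star v * v * star v = star v := fun v hv => by
    simpa [mul_assoc] using aux_star (h3 v hv)
  have h1' : ∀ v ∈ S, e * star v = star v := fun v hv => by
    simpa [he.1] using aux_star (h1 v hv)
  have h2' : ∀ v ∈ S, star v * f = star v := fun v hv => by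
    simpa [hf.1] using aux_star (h2 v hv)
  have hEe : E * e = E := by
    have : E * (1 - e) = 0 := by
      rw [hEs]; rintro _ ⟨v, hv, rfl⟩; simp [mul_sub, mul_assoc, h1 v hv]
    rw [mul_sub, mul_one, sub_eq_zero] at this; exact this.symm
  have hFf : F * f = F := by
    have : F * (1 - f) = 0 := by
      rw [hFs]; rintro _ ⟨v, hv, rfl⟩; simp [mul_sub, mul_assoc, h2' v hv]
    rw [mul_sub, mul_one, sub_eq_zero] at this; exact this.symm
  have hfF : f * F = F := by simpa [hF.1, hf.1] using aux_star hFf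
  have heE : e * E = E := by simpa [hE.1, he.1] using aux_star hEe
  have hEv : ∀ v ∈ S, E * v = 0 := fun v hv => by
    rw [← hEe, ← h2 v hv, mul_assoc, ← mul_assoc e, hef]; simp
  have hFv : ∀ v ∈ S, F * star v = 0 := fun v hv => by
    rw [← hFf, ← h1' v hv, mul_assoc, ← mul_assoc f, hfe]; simp
  have hvE : ∀ v ∈ S, v * E = v := fun v hv => by
    have := aux_supp_mul hE hEs ⟨v, hv, rfl⟩
    rw [← h3 v hv, mul_assoc v, mul_assoc, this]
  have hEv' : ∀ v ∈ S, E * star v = star v := fun v hv => by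
    simpa [hE.1] using aux_star (hvE v hv)
  have hvF : ∀ v ∈ S, star v * F = star v := fun v hv => by
    have := aux_supp_mul hF hFs ⟨v, hv, rfl⟩
    simp only at this
    rw [← h3' v hv, mul_assoc (star v), mul_assoc, this]
  have hFv' : ∀ v ∈ S, F * v = v := fun v hv => by
    simpa [hF.1] using aux_star (hvF v hv)
  have hvF0 : ∀ v ∈ S, v * F = 0 := fun v hv => by
    simpa [hF.1] using aux_star (hFv v hv)
  have hvE0 : ∀ v ∈ S, star v * E = 0 := fun v hv => by
    simpa [hE.1] using aux_star (hEv v hv)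
  have hvv : ∀ v ∈ S, ∀ w ∈ S, v * w = 0 := fun v hv w hw => by
    rw [← hvE v hv, mul_assoc, hEv w hw, mul_zero]
  have hvv' : ∀ v ∈ S, ∀ w ∈ S, star v * star w = 0 := fun v hv w hw => by
    simpa using aux_star (hvv w hw v hv)
  have hgG : ∀ v ∈ S, g * (star v * v + v * star v + v + star v)
      = star v * v + v * star v + v + star v := fun v hv => by
    have := aux_star (aux_supp_mul hg hgs ⟨v, hv, rfl⟩)
    simp only [star_add, star_mul, star_star, hg.1] at this
    rw [add_assoc _ v, add_comm v, ← add_assoc]; exact this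
  -- products G_t * v and G_t * star v
  have hGv : ∀ v ∈ S, (star v * v + v * star v + v + star v) * v = v + star v * v := fun v hv => by
    simp only [add_mul, h3 v hv, hvv v hv v hv, mul_assoc (star v)]; simp
  have hGv' : ∀ v ∈ S, (star v * v + v * star v + v + star v) * star v = star v + v * star v :=
    fun v hv => by
    simp only [add_mul, h3' v hv, hvv' v hv v hv, mul_assoc v]; simp
  have hGo : ∀ t ∈ S, ∀ v ∈ S, t ≠ v → (star t * t + t * star t + t + star t) * v = 0 :=
    fun t ht v hv htv => by
    simp only [add_mul, mul_assoc, hvv t ht v hv, (h4 t ht v hv htv).2]; simp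
  have hGo' : ∀ t ∈ S, ∀ v ∈ S, t ≠ v → (star t * t + t * star t + t + star t) * star v = 0 :=
    fun t ht v hv htv => by
    simp only [add_mul, mul_assoc, hvv' t ht v hv, (h4 t ht v hv htv).1]; simp
  have key : ∀ v ∈ S, g * v = g * (star v * v) := fun v hv => by
    rw [← sub_eq_zero, ← mul_sub, hgs]
    rintro _ ⟨t, ht, rfl⟩
    simp only
    by_cases htv : t = v
    · subst htv
      rw [mul_sub, hGv t ht, ← mul_assoc, hGv' t ht, add_mul, h3 t ht]; abel
    · rw [mul_sub, ← mul_assoc, hGo t ht v hv htv, hGo' t ht v hv htv]; simp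
  have key' : ∀ v ∈ S, g * star v = g * (v * star v) := fun v hv => by
    rw [← sub_eq_zero, ← mul_sub, hgs]
    rintro _ ⟨t, ht, rfl⟩
    simp only
    by_cases htv : t = v
    · subst htv
      rw [mul_sub, hGv' t ht, ← mul_assoc, hGv t ht, add_mul, h3' t ht]; abel
    · rw [mul_sub, ← mul_assoc, hGo t ht v hv htv, hGo' t ht v hv htv]; simp
  have keyA : ∀ v ∈ S, g * (star v * v) + g * (star v * v) = star v * v + v := fun v hv => by
    have a1 := congrArg (· * v) (hgG v hv)
    simp only [mul_assoc g] at a1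
    rw [hGv v hv, mul_add, key v hv] at a1
    rw [a1, add_comm]
  have keyB : ∀ v ∈ S, g * (v * star v) + g * (v * star v) = v * star v + star v := fun v hv => by
    have a1 := congrArg (· * star v) (hgG v hv)
    simp only [mul_assoc g] at a1
    rw [hGv' v hv, mul_add, key' v hv] at a1
    rw [a1, add_comm]
  have hEgE : E * g * E + E * g * E = E := by
    have : (E * g + E * g - 1) * E = 0 := by
      apply hEl
      rintro _ ⟨v, hv, rfl⟩
      simp only
      have : (E * g + E * g - 1) * (star v * v)
        = E * (g * (star v * v) + g * (star v * v)) - star v * v := by noncomm_ring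
      rw [this, keyA v hv, mul_add, hEv v hv, ← mul_assoc, hEv' v hv]; simp
    rw [sub_mul, one_mul, sub_eq_zero, add_mul] at this; exact this
  have hFgF : F * g * F + F * g * F = F := by
    have : (F * g + F * g - 1) * F = 0 := by
      apply hFl
      rintro _ ⟨v, hv, rfl⟩
      simp only
      have : (F * g + F * g - 1) * (v * star v)
        = F * (g * (v * star v) + g * (v * star v)) - v * star v := by noncomm_ring
      rw [this, keyB v hv, mul_add, hFv v hv, ← mul_assoc, hFv' v hv]; simp
    rw [sub_mul, one_mul, sub_eq_zero, add_mul] at this; exact this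
  have hgEF : g * (E + F) = g := by
    have : g * (1 - (E + F)) = 0 := by
      rw [hgs]; rintro _ ⟨v, hv, rfl⟩
      simp only [mul_sub, mul_add, mul_one, add_mul, mul_assoc, hvE v hv, hvE0 v hv, hvF v hv,
        hvF0 v hv, mul_zero]
      abel
    rw [mul_sub, mul_one, sub_eq_zero] at this; exact this.symm
  have hgg : g * E * g + g * F * g = g := by
    rw [← add_mul, ← mul_add, hgEF, hg.2]
  have hW1 : star (F * g * E + F * g * E) * (F * g * E + F * g * E) = E := by
    have s1 : star (F * g * E + F * g * E) = E * g * F + E * g * F := by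
      simp [hE.1, hF.1, hg.1, mul_assoc]
    rw [s1]
    have a : (E * g * F + E * g * F) * (F * g * E + F * g * E)
      = 4 • (E * (g * E * g + g * F * g) * E) - (E * g * E + E * g * E) * (E * g * E + E * g * E)
        + 4 • (E * g * (F * F - F) * g * E) + 4 • (E * g * (E * E - E) * g * E) := by noncomm_ring
    rw [a, hgg, hEgE, hE.2, hF.2]
    have : (4 : ℕ) • (E * g * E) = (E * g * E + E * g * E) + (E * g * E + E * g * E) := by abel
    rw [this, hEgE]; simp
  have hW2 : (F * g * E + F * g * E) * star (F * g * E + F * g * E) = F := by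
    have s1 : star (F * g * E + F * g * E) = E * g * F + E * g * F := by
      simp [hE.1, hF.1, hg.1, mul_assoc]
    rw [s1]
    have a : (F * g * E + F * g * E) * (E * g * F + E * g * F)
      = 4 • (F * (g * E * g + g * F * g) * F) - (F * g * F + F * g * F) * (F * g * F + F * g * F)
        + 4 • (F * g * (E * E - E) * g * F) + 4 • (F * g * (F * F - F) * g * F) := by noncomm_ring
    rw [a, hgg, hFgF, hE.2, hF.2]
    have : (4 : ℕ) • (F * g * F) = (F * g * F + F * g * F) + (F * g * F + F * g * F) := by abel
    rw [this, hFgF]; simp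
  refine ⟨F * g * E + F * g * E, ?_, ?_, ?_, ?_, ?_⟩
  · rw [hW2, mul_add, ← mul_assoc, ← mul_assoc, hF.2]
  · simp [add_mul, mul_assoc, hEe]
  · simp only [mul_add, ← mul_assoc, hfF]
  · intro v hv; rw [hW1, hvE v hv]
  · intro v hv; rw [hW2, hFv' v hv]

/-- Partial comparability -/
theorem aux_pc {A : Type u} [CStarAlgebra A] (hAW : IsAWStarRing A) (x : A) (hx : x ≠ 0) :
    ∃ v d : A, v ≠ 0 ∧ v * star v * v = v ∧ v = x * d ∧ ∃ d', star v = d' * star x ∧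
      ∃ d'', v = d'' * x := by
  set b := star x * x with hb
  have hbs : IsSelfAdjoint b := IsSelfAdjoint.star_mul_self x
  have hb0 : b ≠ 0 := by rw [hb]; exact (CStarRing.star_mul_self_ne_zero_iff x).2 hx
  obtain ⟨t, ht, htpos⟩ : ∃ t ∈ spectrum ℝ b, 0 < t := by
    by_contra! hcon
    apply hb0
    have : ∀ t ∈ spectrum ℝ b, t = 0 := fun t ht =>
      le_antisymm (hcon t ht) (spectrum_star_mul_self_nonneg t ht)
    rw [← cfc_id' ℝ b, cfc_congr (g := fun _ => (0:ℝ)) (fun t ht => this t ht)]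
    simp
  set δ := t / 2 with hδ
  have hδp : 0 < δ := by positivity
  have c1 : Continuous (fun s : ℝ => max (s - δ) 0) := by fun_prop
  have c2 : Continuous (fun s : ℝ => max (δ - s) 0) := by fun_prop
  have c3 : Continuous (fun s : ℝ => (Real.sqrt (max s δ))⁻¹) := by
    apply Continuous.inv₀ (by fun_prop)
    intro s
    have : 0 < max s δ := lt_max_of_lt_right hδp
    positivity
  set H := cfc (fun s : ℝ => max (s - δ) 0) b with hH
  set K := cfc (fun s : ℝ => max (δ - s) 0) b with hK
  set d := cfc (fun s : ℝ => (Real.sqrt (max s δ))⁻¹) b with hd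
  have hH0 : H ≠ 0 := by
    intro h0
    have hm : max (t - δ) 0 ∈ spectrum ℝ H := by
      rw [hH, cfc_map_spectrum (R := ℝ) _ b hbs c1.continuousOn]
      exact ⟨t, ht, rfl⟩
    have hnt : Nontrivial A := ⟨⟨x, 0, hx⟩⟩
    rw [h0, spectrum.zero_eq] at hm
    have : max (t - δ) 0 = 0 := hm
    have h2 := le_max_left (t - δ) 0
    rw [this] at h2
    linarith
  have hds : star d = d := (cfc_predicate (R := ℝ) (p := IsSelfAdjoint) _ b)
  have hHs : star H = H := (cfc_predicate (R := ℝ) (p := IsSelfAdjoint) _ b)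
  have hKs : star K = K := (cfc_predicate (R := ℝ) (p := IsSelfAdjoint) _ b)
  have hHK : H * K = 0 := by
    rw [hH, hK, ← cfc_mul _ _ b c1.continuousOn c2.continuousOn]
    rw [cfc_congr (g := fun _ => (0:ℝ))]
    · simp
    · intro s _
      simp only
      rcases le_total s δ with h | h
      · rw [max_eq_right (by linarith), zero_mul]
      · rw [max_eq_right (a := δ - s) (by linarith), mul_zero]
  have hbd : b * d = d * b := by
    have := cfc_commute_cfc (fun s : ℝ => s) (fun s : ℝ => (Real.sqrt (max s δ))⁻¹) b
    rw [cfc_id' ℝ b] at this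
    exact this
  have hHd : H * d = d * H := cfc_commute_cfc _ _ b
  have hbH : H * b = b * H := by
    have := cfc_commute_cfc (fun s : ℝ => max (s - δ) 0) (fun s : ℝ => s) b
    rw [cfc_id' ℝ b] at this
    exact this
  have c4 : Continuous (fun s : ℝ => s + max (δ - s) 0) := by fun_prop
  have c5 : Continuous (fun s : ℝ => (Real.sqrt (max s δ))⁻¹ * (s + max (δ - s) 0)) := c3.mul c4
  have hbKd : d * (b + K) * d = 1 := by
    conv_lhs => rw [← cfc_id' ℝ b]
    rw [hK, hd, ← cfc_add b _ _ continuous_id'.continuousOn c2.continuousOn,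
      ← cfc_mul _ _ b c3.continuousOn c4.continuousOn,
      ← cfc_mul _ _ b c5.continuousOn c3.continuousOn]
    rw [cfc_congr (g := fun _ => (1:ℝ)), cfc_const_one ℝ b]
    intro s _
    simp only
    have hp : 0 < max s δ := lt_max_of_lt_right hδp
    have h1 : s + max (δ - s) 0 = max s δ := by
      rcases le_total s δ with h | h
      · rw [max_eq_left (by linarith), max_eq_right h]; ring
      · rw [max_eq_right (by linarith), max_eq_left h]; ring
    rw [h1]
    have h2 := Real.mul_self_sqrt hp.le
    have h3 : Real.sqrt (max s δ) ≠ 0 := (Real.sqrt_pos.2 hp).ne'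
    field_simp
    nlinarith
  obtain ⟨p, hp, hps'⟩ := aux_supp hAW {H}
  have hps : ∀ x, p * x = 0 ↔ H * x = 0 := fun x => by simpa using hps' x
  have hHp : H * p = H := aux_supp_mul hp hps' rfl
  have hp0 : p ≠ 0 := by rintro rfl; exact hH0 (by rw [← hHp, mul_zero])
  have hpK : p * K = 0 := (hps K).2 hHK
  have hpd : p * d = d * p := aux_comm hp hps hHd (by rw [hds]; exact hHd)
  have hpb : p * b = b * p := aux_comm hp hps hbH (by rw [hbs.star_eq]; exact hbH)
  have hpdbd : p * (d * b * d) = p := by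
    have : d * b * d = 1 - d * K * d := by rw [← hbKd]; noncomm_ring
    rw [this, mul_sub, mul_one, ← mul_assoc, ← mul_assoc, hpd, mul_assoc d p K, hpK]; simp
  have hvv : star (x * (d * p)) * (x * (d * p)) = p := by
    simp only [star_mul, hds, hp.1]
    calc p * d * star x * (x * (d * p)) = p * (d * (star x * x) * d) * p := by noncomm_ring
      _ = p := by rw [← hb, hpdbd, hp.2]
  refine ⟨x * (d * p), d * p, ?_, ?_, rfl, p * d, by simp [hds, hp.1], x * (d * p) * d * d * star x, ?_⟩
  · intro h0; rw [h0] at hvv; simp at hvv; exact hp0 hvv.symm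
  · rw [mul_assoc, hvv, mul_assoc, mul_assoc, hp.2]
  · have : p = p * d * d * star x * x := by
      calc p = p * (d * b * d) := hpdbd.symm
        _ = p * (d * (b * d)) := by rw [mul_assoc d]
        _ = p * d * d * star x * x := by rw [hbd, hb]; noncomm_ring
    calc x * (d * p) = x * (d * (p * d * d * star x * x)) := by rw [← this]
      _ = _ := by noncomm_ring

/-- orthogonal comparability -/
theorem aux_ogc {A : Type u} [CStarAlgebra A] (hAW : IsAWStarRing A)
    (e f : A) (he : IsProjection e) (hf : IsProjection f) (hef : e * f = 0) :
    ∃ w h : A, w * star w * w = w ∧ w * e = w ∧ f * w = w ∧ IsCentralProj h ∧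
      h * (e - star w * w) = 0 ∧ (1 - h) * (f - w * star w) = 0 := by
  let P : Set (Set A) := {S | (∀ v ∈ S, v * e = v ∧ f * v = v ∧ v * star v * v = v) ∧
    ∀ v ∈ S, ∀ w ∈ S, v ≠ w → v * star w = 0 ∧ star v * w = 0}
  obtain ⟨S, hS⟩ : ∃ S, Maximal (· ∈ P) S := by
    apply zorn_subset
    intro c hc hch
    refine ⟨⋃₀ c, ⟨?_, ?_⟩, fun s hs => Set.subset_sUnion_of_mem hs⟩
    · rintro v ⟨s, hs, hv⟩; exact (hc hs).1 v hv
    · rintro v ⟨s, hs, hv⟩ w ⟨s', hs', hw⟩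
      rcases hch.total hs hs' with h | h
      · exact (hc hs').2 v (h hv) w hw
      · exact (hc hs).2 v hv w (h hw)
  obtain ⟨w, hw, hwe, hfw, hvw, hwv⟩ := aux_add hAW e f he hf hef S
    (fun v hv => (hS.1.1 v hv).1) (fun v hv => (hS.1.1 v hv).2.1)
    (fun v hv => (hS.1.1 v hv).2.2) hS.1.2
  have hew : e * star w = star w := by simpa [he.1] using aux_star hwe
  have hwf : star w * f = star w := by simpa [hf.1] using aux_star hfw
  have hw' : star w * w * star w = star w := by simpa [mul_assoc] using aux_star hw
  set e0 := e - star w * w with he0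
  set f0 := f - w * star w with hf0
  have he0e : e0 * e = e0 := by rw [he0, sub_mul, he.2, mul_assoc, hwe]
  have hff0 : f * f0 = f0 := by rw [hf0, mul_sub, hf.2, ← mul_assoc, hfw]
  have he0s : star e0 = e0 := by simp [he0, he.1]
  have hf0s : star f0 = f0 := by simp [hf0, hf.1]
  have he0w : star w * w * e0 = 0 := by
    rw [he0, mul_sub, mul_assoc, hwe, ← mul_assoc, hw', sub_self]
  have hf0w : f0 * (w * star w) = 0 := by
    rw [hf0, sub_mul, ← mul_assoc, hfw, ← mul_assoc, hw, sub_self]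
  have hf0w' : (w * star w) * f0 = 0 := by simpa [hf0s] using aux_star hf0w
  have hve0 : ∀ v ∈ S, v * e0 = 0 := fun v hv => by
    rw [← hvw v hv, mul_assoc, he0w, mul_zero]
  have hf0v : ∀ v ∈ S, f0 * v = 0 := fun v hv => by
    rw [← hwv v hv, ← mul_assoc, hf0w, zero_mul]
  have main : ∀ y, f0 * (y * e0) = 0 := by
    intro y
    by_contra hne
    obtain ⟨v, d, hv0, hv, hvd, d', hd', d'', hd''⟩ := aux_pc hAW _ hne
    have hve : v * e0 = v * e := by
      have h0 : v * (star w * w) = 0 := by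
        have : e0 * (star w * w) = 0 := by simpa [he0s] using aux_star he0w
        rw [hd'', mul_assoc, mul_assoc, mul_assoc, this]; simp
      rw [he0, mul_sub, h0, sub_zero]
    have hve1 : v * e = v := by rw [hd'']; simp only [mul_assoc, he0e]
    have hfv1 : f * v = v := by rw [hvd]; simp only [← mul_assoc, hff0]
    have hvS : ∀ u ∈ S, v * star u = 0 ∧ star v * u = 0 := fun u hu => by
      constructor
      · rw [hd'', mul_assoc, mul_assoc, mul_assoc]
        have : e0 * star u = 0 := by simpa [he0s] using aux_star (hve0 u hu)
        rw [this]; simp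
      · rw [hd', star_mul, hf0s, mul_assoc, mul_assoc, hf0v u hu]; simp
    have hins : insert v S ∈ P := by
      constructor
      · rintro u (rfl | hu)
        · exact ⟨hve1, hfv1, hv⟩
        · exact hS.1.1 u hu
      · rintro u (rfl | hu) u' (rfl | hu') hne
        · exact absurd rfl hne
        · exact hvS u' hu'
        · have := hvS u hu
          exact ⟨by simpa using aux_star this.1, by simpa using aux_star this.2⟩
        · exact hS.1.2 u hu u' hu' hne
    have hvin : v ∈ S := hS.2 hins (Set.subset_insert v S) (Set.mem_insert v S)
    apply hv0
    rw [← hve1, ← hve, hve0 v hvin]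
  obtain ⟨s, hs, hss⟩ := aux_supp hAW (Set.range (fun y => f0 * y))
  have hss' : ∀ x, s * x = 0 ↔ ∀ y, f0 * y * x = 0 := fun x => by
    rw [hss]; simp
  have hsas : ∀ a, s * (a * (1 - s)) = 0 := fun a => by
    rw [hss']
    intro y
    have h0 := (hss' (1 - s)).1 (by rw [mul_sub, mul_one, hs.2, sub_self]) (y * a)
    rw [← h0]; noncomm_ring
  refine ⟨w, s, hw, hwe, hfw, ⟨hs, fun a => ?_⟩, ?_, ?_⟩
  · have k1 := hsas a
    have k2 := aux_star (hsas (star a))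
    simp only [star_mul, star_sub, star_one, star_star, hs.1, star_zero] at k2
    rw [mul_sub, mul_sub, mul_one, sub_eq_zero] at k1
    rw [sub_mul, one_mul, sub_mul, sub_eq_zero] at k2
    rw [k2, mul_assoc]; exact k1
  · rw [hss']; intro y; rw [mul_assoc]; exact main y
  · have h0 := (hss' (1 - s)).1 (by rw [mul_sub, mul_one, hs.2, sub_self]) 1
    rw [mul_one] at h0
    simpa [hs.1, hf0s] using aux_star h0

/-- two projections: reduction to the orthogonal case -/
theorem aux_two {A : Type u} [CStarAlgebra A] (hAW : IsAWStarRing A)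
    (e f : A) (he : IsProjection e) (hf : IsProjection f) :
    ∃ u s : A, star u = u ∧ IsProjection s ∧ u * u = s ∧ u * e = f * u ∧ s * e = e * s ∧
      s * f = f * s ∧ e * f * (1 - s) = 0 := by
  set a := e + f - 1 with ha
  have has : IsSelfAdjoint a := by
    rw [isSelfAdjoint_iff]; simp [ha, he.1, hf.1]
  have hae : a * e = f * a := by
    rw [ha]
    have : (e + f - 1) * e = f * (e + f - 1) + (e * e - e) - (f * f - f) := by noncomm_ring
    rw [this, he.2, hf.2]; simp
  have hea : e * a = a * f := by simpa [has.star_eq, he.1, hf.1] using aux_star hae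
  have c1 : Continuous (fun s : ℝ => max s 0) := by fun_prop
  have c2 : Continuous (fun s : ℝ => max (-s) 0) := by fun_prop
  set P := cfc (fun s : ℝ => max s 0) a with hP
  set N := cfc (fun s : ℝ => max (-s) 0) a with hN
  have hPs : star P = P := (cfc_predicate (R := ℝ) (p := IsSelfAdjoint) _ a)
  have hNs : star N = N := (cfc_predicate (R := ℝ) (p := IsSelfAdjoint) _ a)
  have hPN : P * N = 0 := by
    rw [hP, hN, ← cfc_mul _ _ a c1.continuousOn c2.continuousOn]
    rw [cfc_congr (g := fun _ => (0:ℝ))]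
    · simp
    · intro s _
      simp only
      rcases le_total s 0 with h | h
      · rw [max_eq_right h, zero_mul]
      · rw [max_eq_right (a := -s) (by linarith), mul_zero]
  have hNP : N * P = 0 := by simpa [hPs, hNs] using aux_star hPN
  have haPN : P - N = a := by
    rw [hP, hN, ← cfc_sub _ _ a c1.continuousOn c2.continuousOn]
    conv_rhs => rw [← cfc_id' ℝ a]
    apply cfc_congr
    intro s _
    simp only
    rcases le_total s 0 with h | h
    · rw [max_eq_right h, max_eq_left (by linarith)]; ring
    · rw [max_eq_left h, max_eq_right (by linarith)]; ring
  have hM : P + N = cfc Real.sqrt (a ^ 2) := by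
    rw [← cfc_comp_pow Real.sqrt 2 a (Real.continuous_sqrt.continuousOn) has,
      hP, hN, ← cfc_add a _ _ c1.continuousOn c2.continuousOn]
    apply cfc_congr
    intro s _
    simp only
    rw [Real.sqrt_sq_eq_abs]
    rcases le_total s 0 with h | h
    · rw [max_eq_right h, max_eq_left (by linarith), abs_of_nonpos h]; ring
    · rw [max_eq_left h, max_eq_right (by linarith), abs_of_nonneg h]; ring
  have hMc : ∀ c, Commute (a ^ 2) c → (P + N) * c = c * (P + N) := fun c hc => by
    rw [hM]
    exact (Commute.cfc_real (a := a ^ 2) hc Real.sqrt)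
  have hMe : (P + N) * e = e * (P + N) := hMc e (by
    show a ^ 2 * e = e * a ^ 2
    have : f * a = a * e := hae.symm
    rw [pow_two, mul_assoc, hae, ← mul_assoc, ← mul_assoc, hea])
  have hMf : (P + N) * f = f * (P + N) := hMc f (by
    show a ^ 2 * f = f * a ^ 2
    rw [pow_two, mul_assoc, ← hea, ← mul_assoc, ← mul_assoc, hae])
  obtain ⟨p, hp, hps'⟩ := aux_supp hAW {P}
  have hps : ∀ x, p * x = 0 ↔ P * x = 0 := fun x => by simpa using hps' x
  obtain ⟨q, hq, hqs'⟩ := aux_supp hAW {N}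
  have hqs : ∀ x, q * x = 0 ↔ N * x = 0 := fun x => by simpa using hqs' x
  have hPp : P * p = P := aux_supp_mul hp hps' rfl
  have hNq : N * q = N := aux_supp_mul hq hqs' rfl
  have hNp : N * p = 0 := by simpa [hNs, hp.1] using aux_star ((hps N).2 hPN)
  have hPq : P * q = 0 := by simpa [hPs, hq.1] using aux_star ((hqs P).2 hNP)
  have hqp : q * p = 0 := (hqs p).2 hNp
  have hpq : p * q = 0 := (hps q).2 hPq
  have hu : star (p - q) = p - q := by simp [hp.1, hq.1]
  have huu : (p - q) * (p - q) = p + q := by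
    simp [mul_sub, sub_mul, hp.2, hq.2, hpq, hqp]
  have hs : IsProjection (p + q) := ⟨by simp [hp.1, hq.1], by
    simp [mul_add, add_mul, hp.2, hq.2, hpq, hqp]⟩
  have hPP : ∀ x, P * (P * x) = 0 → P * x = 0 := fun x hx => by
    rw [← CStarRing.star_mul_self_eq_zero_iff, star_mul, hPs, mul_assoc, hx, mul_zero]
  have hNN : ∀ x, N * (N * x) = 0 → N * x = 0 := fun x hx => by
    rw [← CStarRing.star_mul_self_eq_zero_iff, star_mul, hNs, mul_assoc, hx, mul_zero]
  have hsM : ∀ x, (p + q) * x = 0 ↔ (P + N) * x = 0 := fun x => by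
    constructor
    · intro h
      have h1 : p * x = 0 := by
        have := congrArg (p * ·) h
        simpa [add_mul, mul_add, ← mul_assoc, hp.2, hpq] using this
      have h2 : q * x = 0 := by
        have := congrArg (q * ·) h
        simpa [add_mul, mul_add, ← mul_assoc, hq.2, hqp] using this
      rw [add_mul, (hps x).1 h1, (hqs x).1 h2, add_zero]
    · intro h
      have h1 : P * x = 0 := hPP x (by
        have := congrArg (P * ·) h
        simpa [add_mul, mul_add, ← mul_assoc, hPN] using this)
      have h2 : N * x = 0 := hNN x (by
        have := congrArg (N * ·) h
        simpa [add_mul, mul_add, ← mul_assoc, hNP] using this)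
      rw [add_mul, (hps x).2 h1, (hqs x).2 h2, add_zero]
  have hse : (p + q) * e = e * (p + q) := aux_comm hs hsM hMe (by rw [he.1]; exact hMe)
  have hsf : (p + q) * f = f * (p + q) := aux_comm hs hsM hMf (by rw [hf.1]; exact hMf)
  have hMu : (P + N) * (p - q) = a := by
    rw [← haPN]; simp [add_mul, mul_sub, hPp, hNq, hNp, hPq]
  have huM : (p - q) * (P + N) = a := by
    simpa [hPs, hNs, hp.1, hq.1, has.star_eq] using aux_star hMu
  have hsu : (p + q) * (p - q) = p - q := by
    simp [add_mul, mul_sub, hp.2, hq.2, hpq, hqp]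
  refine ⟨p - q, p + q, hu, hs, huu, ?_, hse, hsf, ?_⟩
  · have : (p + q) * ((p - q) * e - f * (p - q)) = 0 := by
      rw [hsM, mul_sub, ← mul_assoc, hMu, ← mul_assoc, hMf, mul_assoc, hMu, hae, sub_self]
    rw [mul_sub, ← mul_assoc, hsu, ← mul_assoc, hsf, mul_assoc, hsu, sub_eq_zero] at this
    exact this
  · have h0 : (P + N) * (1 - (p + q)) = 0 := (hsM _).1 (by rw [mul_sub, mul_one, hs.2, sub_self])
    have h1 : a * (1 - (p + q)) = 0 := by rw [← huM, mul_assoc, h0, mul_zero]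
    have h2 : e * f = e * a := by rw [ha, mul_sub, mul_add, he.2]; simp
    rw [h2, mul_assoc, h1, mul_zero]

/-- generalized comparability -/
theorem aux_gc {A : Type u} [CStarAlgebra A] (hAW : IsAWStarRing A)
    (e f : A) (he : IsProjection e) (hf : IsProjection f) :
    ∃ w h : A, w * star w * w = w ∧ w * e = w ∧ f * w = w ∧ IsCentralProj h ∧
      h * (e - star w * w) = 0 ∧ (1 - h) * (f - w * star w) = 0 := by
  obtain ⟨u, s, hu, hs, huu, hue, hse, hsf, hefs⟩ := aux_two hAW e f he hf
  set r := 1 - s with hr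
  have hrr : r * r = r := by simp [hr, mul_sub, sub_mul, hs.2]
  have hrs : star r = r := by simp [hr, hs.1]
  have hre : r * e = e * r := by rw [hr, sub_mul, mul_sub, hse]; simp
  have hrf : r * f = f * r := by rw [hr, sub_mul, mul_sub, hsf]; simp
  have hsr : s * r = 0 := by simp [hr, mul_sub, hs.2]
  have hrs0 : r * s = 0 := by simp [hr, sub_mul, hs.2]
  have he2 : IsProjection (e * r) := ⟨by rw [star_mul, hrs, he.1, hre], by
    rw [mul_assoc, ← mul_assoc r, hre, mul_assoc e r r, hrr, ← mul_assoc, he.2]⟩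
  have hf2 : IsProjection (f * r) := ⟨by rw [star_mul, hrs, hf.1, hrf], by
    rw [mul_assoc, ← mul_assoc r, hrf, mul_assoc f r r, hrr, ← mul_assoc, hf.2]⟩
  have hef2 : (e * r) * (f * r) = 0 := by
    rw [mul_assoc, ← mul_assoc r, hrf, mul_assoc f, hrr, ← mul_assoc, hefs]
  obtain ⟨w, h, hw, hwe, hfw, hh, h1, h2⟩ := aux_ogc hAW _ _ he2 hf2 hef2
  have hwr : w * r = w := by rw [← hwe, mul_assoc, mul_assoc, hrr]
  have hrw : r * w = w := by rw [← hfw, ← mul_assoc, ← mul_assoc, hrf, mul_assoc f, hrr]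
  have hwe' : w * e = w := by
    rw [← hwe, mul_assoc, mul_assoc, hre, ← mul_assoc e, he.2]
  have hfw' : f * w = w := by
    rw [← hfw, ← mul_assoc, ← mul_assoc, hf.2]
  have heu : e * u = u * f := by simpa [hu, he.1, hf.1] using aux_star hue
  have hsu : s * u = u * s := by rw [← huu, mul_assoc]
  have hur : u * r = r * u := by rw [hr, sub_mul, mul_sub, hsu]; simp
  have hur0 : u * r = 0 := by
    have h0 : star (u * r) * (u * r) = 0 := by
      rw [star_mul, hu, hrs, mul_assoc, ← mul_assoc u u, huu, hsr, mul_zero]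
    exact (CStarRing.star_mul_self_eq_zero_iff _).1 h0
  have hru0 : r * u = 0 := by rw [← hur, hur0]
  have huw : u * w = 0 := by rw [← hrw, ← mul_assoc, hur0, zero_mul]
  have hwu : w * u = 0 := by rw [← hwr, mul_assoc, hru0, mul_zero]
  have huw' : u * star w = 0 := by simpa [hu] using aux_star hwu
  have hwu' : star w * u = 0 := by simpa [hu] using aux_star huw
  have hsv : star (u * e) = e * u := by rw [star_mul, hu, he.1]
  have hew' : e * star w = star w := by simpa [he.1] using aux_star hwe'
  have hW1 : star (u * e + w) * (u * e + w) = e * s + star w * w := by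
    rw [star_add, hsv, add_mul, mul_add, mul_add]
    have t1 : e * u * (u * e) = e * s := by
      rw [mul_assoc, ← mul_assoc u, huu, hse, ← mul_assoc, he.2]
    have t2 : e * u * w = 0 := by rw [mul_assoc, huw, mul_zero]
    have t3 : star w * (u * e) = 0 := by rw [← mul_assoc, hwu', zero_mul]
    rw [t1, t2, t3]; simp
  have hW2 : (u * e + w) * star (u * e + w) = f * s + w * star w := by
    rw [star_add, hsv, add_mul, mul_add, mul_add]
    have t1 : u * e * (e * u) = f * s := by
      rw [mul_assoc, ← mul_assoc e, he.2, ← mul_assoc, hue, mul_assoc, huu]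
    have t2 : u * e * star w = 0 := by rw [mul_assoc, hew', huw']
    have t3 : w * (e * u) = 0 := by rw [← mul_assoc, hwe', hwu]
    rw [t1, t2, t3]; simp
  have hsuu : s * u = u := by
    have : (1 - s) * u = 0 := hru0
    rw [sub_mul, one_mul, sub_eq_zero] at this; exact this.symm
  refine ⟨u * e + w, h, ?_, ?_, ?_, hh, ?_, ?_⟩
  · rw [hW2, add_mul, mul_add, mul_add, hw]
    have t1 : f * s * (u * e) = u * e := by
      rw [mul_assoc, ← mul_assoc s, hsuu, hue, ← mul_assoc, hf.2]
    have t2 : f * s * w = 0 := by rw [← hrw, mul_assoc, ← mul_assoc s, hsr]; simp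
    have t3 : w * star w * (u * e) = 0 := by rw [mul_assoc, ← mul_assoc (star w), hwu']; simp
    rw [t1, t2, t3]; simp
  · rw [add_mul, mul_assoc, he.2, hwe']
  · rw [mul_add, hfw', hue, ← mul_assoc, hf.2]
  · rw [hW1, ← h1, hr]; noncomm_ring
  · rw [hW2, ← h2, hr]; noncomm_ring

theorem comparison_theorem {A : Type u} [NormedRing A] [StarRing A] [CStarRing A]
    [NormedAlgebra ℂ A] [StarModule ℂ A] [CompleteSpace A]
    (hAW : IsAWStarRing A) (e f : A) (he : IsProjection e) (hf : IsProjection f) :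
    ∃ x y z : A, IsCentralProj x ∧ IsCentralProj y ∧ IsCentralProj z ∧
      x * y = 0 ∧ x * z = 0 ∧ y * z = 0 ∧ x + y + z = 1 ∧
      ProjLT (x * e) (x * f) ∧ ProjEquiv (y * e) (y * f) ∧ ProjLT (z * f) (z * e) := by
  letI : CStarAlgebra A := {}
  obtain ⟨w, h, hw, hwe, hfw, ⟨hh, hc⟩, h1, h2⟩ := aux_gc hAW e f he hf
  have hw' : star w * w * star w = star w := by simpa [mul_assoc] using aux_star hw
  have hwf : star w * f = star w := by simpa [hf.1] using aux_star hfw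
  have hc0 : IsCentralProj (0 : A) := ⟨⟨by simp, by simp⟩, by simp⟩
  have hc1 : IsCentralProj (1 : A) := ⟨⟨by simp, by simp⟩, by simp⟩
  have hk : IsProjection (1 - h) := ⟨by simp [hh.1], by simp [mul_sub, sub_mul, hh.2]⟩
  have hkc : ∀ a, (1 - h) * a = a * (1 - h) := fun a => by rw [sub_mul, mul_sub, hc]; simp
  have hhk : h * (1 - h) = 0 := by simp [mul_sub, hh.2]
  have hkh : (1 - h) * h = 0 := by simp [sub_mul, hh.2]
  have hhe : h * e = h * (star w * w) := by rw [mul_sub, sub_eq_zero] at h1; exact h1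
  have hkf : (1 - h) * f = (1 - h) * (w * star w) := by
    rw [mul_sub, sub_eq_zero] at h2; exact h2
  -- first subequivalence
  have q1 : ∀ z : A, IsProjection z → (∀ a, z * a = a * z) →
      star (z * w) * (z * w) = z * (star w * w) ∧ z * w * star (z * w) = z * (w * star w) := by
    intro z hz hzc
    have e1 : star (z * w) = z * star w := by rw [star_mul, hz.1, hzc]
    rw [e1]
    constructor
    · rw [mul_assoc, ← mul_assoc _ z, ← hzc (star w), mul_assoc z (star w), ← mul_assoc z z, hz.2]
    · rw [mul_assoc, ← mul_assoc _ z, ← hzc w, mul_assoc z w, ← mul_assoc z z, hz.2]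
  have hpr : ∀ z : A, IsProjection z → (∀ a, z * a = a * z) → ∀ p : A, IsProjection p →
      IsProjection (z * p) := by
    intro z hz hzc p hp
    refine ⟨by rw [star_mul, hz.1, hp.1, hzc], ?_⟩
    rw [mul_assoc, ← mul_assoc p, ← hzc p, mul_assoc z p, hp.2, ← mul_assoc, hz.2]
  have hle : ∀ z : A, IsProjection z → (∀ a, z * a = a * z) → ∀ p q : A, p * q = p →
      ProjLE (z * p) (z * q) := by
    intro z hz hzc p q hpq
    unfold ProjLE
    rw [mul_assoc, ← mul_assoc p, ← hzc p, mul_assoc z p, hpq, ← mul_assoc, hz.2]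
  have hww : IsProjection (w * star w) := ⟨by simp, by rw [← mul_assoc, hw]⟩
  have hww' : IsProjection (star w * w) := ⟨by simp, by rw [← mul_assoc, hw']⟩
  have sub1 : ProjSubEquiv (h * e) (h * f) := by
    refine ⟨h * (w * star w), hpr h hh hc _ hww, hle h hh hc _ _ (by rw [mul_assoc, hwf]),
      h * w, ?_, ?_⟩
    · rw [hhe]; exact (q1 h hh hc).1
    · exact (q1 h hh hc).2
  have sub2 : ProjSubEquiv ((1 - h) * f) ((1 - h) * e) := by
    refine ⟨(1 - h) * (star w * w), hpr _ hk hkc _ hww', hle _ hk hkc _ _ (by rw [mul_assoc, hwe]),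
      star ((1 - h) * w), ?_, ?_⟩
    · rw [hkf, star_star]; exact (q1 _ hk hkc).2
    · rw [star_star]; exact (q1 _ hk hkc).1
  have lt0 : ∀ a b : A, ProjLT (0 * a) (0 * b) := fun a b => Or.inr ⟨by simp, by simp⟩
  have symm : ∀ a b : A, ProjEquiv a b → ProjEquiv b a := by
    rintro a b ⟨v, hv1, hv2⟩
    exact ⟨star v, by rw [star_star, hv2], by rw [star_star, hv1]⟩
  by_cases c1 : ProjEquiv (h * e) (h * f)
  · by_cases c2 : ProjEquiv ((1 - h) * f) ((1 - h) * e)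
    · refine ⟨0, 1, 0, hc0, hc1, hc0, by simp, by simp, by simp, by simp, lt0 _ _, ?_, lt0 _ _⟩
      obtain ⟨v, hv1, hv2⟩ := c1
      obtain ⟨v', hv1', hv2'⟩ := symm _ _ c2
      have cut : ∀ k p t : A, IsProjection k → (∀ a, k * a = a * k) → star t * t = k * p →
          k * t = t := by
        intro k p t hk hkc ht
        have : t * (1 - k) = 0 := by
          rw [← CStarRing.star_mul_self_eq_zero_iff, star_mul, mul_assoc, ← mul_assoc (star t), ht,
            hkc p, mul_assoc, mul_sub k, hk.2]
          simp
        rw [hkc]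
        rw [mul_sub, mul_one, sub_eq_zero] at this; exact this.symm
      have n1 := cut h e v hh hc hv1
      have n2 := cut (1 - h) e v' hk hkc hv1'
      have o1 : star v * v' = 0 := by
        rw [← n1, ← n2, star_mul, hh.1, mul_assoc, ← mul_assoc h, hhk]; simp
      have o2 : star v' * v = 0 := by simpa using aux_star o1
      have o3 : v * star v' = 0 := by
        rw [← n1, ← n2, star_mul, hk.1, ← hkc, hc v, mul_assoc, ← mul_assoc h, hhk]; simp
      have o4 : v' * star v = 0 := by simpa using aux_star o3
      refine ⟨v + v', ?_, ?_⟩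
      · rw [star_add, add_mul, mul_add, mul_add, o1, o2, hv1, hv1']; noncomm_ring
      · rw [star_add, add_mul, mul_add, mul_add, o3, o4, hv2, hv2']; noncomm_ring
    · exact ⟨0, h, 1 - h, hc0, ⟨hh, hc⟩, ⟨hk, hkc⟩, by simp, by simp, hhk, by simp, lt0 _ _, c1,
        Or.inl ⟨sub2, c2⟩⟩
  · by_cases c2 : ProjEquiv ((1 - h) * f) ((1 - h) * e)
    · exact ⟨h, 1 - h, 0, ⟨hh, hc⟩, ⟨hk, hkc⟩, hc0, hhk, by simp, by simp, by simp,
        Or.inl ⟨sub1, c1⟩, symm _ _ c2, lt0 _ _⟩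
    · exact ⟨h, 0, 1 - h, ⟨hh, hc⟩, hc0, ⟨hk, hkc⟩, by simp, hhk, by simp, by simp,
        Or.inl ⟨sub1, c1⟩, ⟨0, by simp, by simp⟩, Or.inl ⟨sub2, c2⟩⟩
end

section
/- Let A be an AW*-algebra such that no nonzero central projection z makes the corner algebra zA commutative (A has no abelian central summands), and let M be a maximal abelian subalgebra of A. Then M contains a projection e with c(e) = 1 = c(1−e) and e ≼ 1−e. -/
universe u

section Abstract

variable {R : Type u} [Ring R] [StarRing R]

lemma aux_ann (h : IsAWStarRing R) (S : Set R) :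
    ∃ n : R, star n = n ∧ n * n = n ∧ ∀ x, (∀ s ∈ S, s * x = 0) ↔ n * x = x := by
  obtain ⟨p, ⟨h1, h2⟩, h3⟩ := h S
  refine ⟨p, h1, h2, fun x => ?_⟩
  have h4 : (∀ s ∈ S, s * x = 0) ↔ ∃ b, x = p * b := by
    have := Set.ext_iff.1 h3 x
    simpa using this
  rw [h4]
  constructor
  · rintro ⟨b, rfl⟩
    rw [← mul_assoc, h2]
  · intro hx
    exact ⟨x, hx.symm⟩

lemma aux_comm_s1 {n b : R} (hn : star n = n) (h1 : n * (b * n) = b * n)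
    (h2 : n * (star b * n) = star b * n) : n * b = b * n := by
  have := congrArg star h2
  simp only [star_mul, star_star, hn] at this
  rw [← h1, ← mul_assoc, this]

lemma aux_ann_comm {S : Set R} {n : R} (hn : star n = n) (hnn : n * n = n)
    (h : ∀ x, (∀ s ∈ S, s * x = 0) ↔ n * x = x) (b : R)
    (h1 : ∀ s ∈ S, s * b = b * s) (h2 : ∀ s ∈ S, s * star b = star b * s) :
    n * b = b * n := by
  have h0 : ∀ s ∈ S, s * n = 0 := (h n).2 hnn
  apply aux_comm_s1 hn
  · apply (h _).1
    intro s hs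
    rw [← mul_assoc, h1 s hs, mul_assoc, h0 s hs, mul_zero]
  · apply (h _).1
    intro s hs
    rw [← mul_assoc, h2 s hs, mul_assoc, h0 s hs, mul_zero]

lemma aux_cann (h : IsAWStarRing R) (r : R) :
    ∃ d : R, IsCentralProj d ∧ ∀ x, (∀ a, r * a * x = 0) ↔ d * x = x := by
  obtain ⟨n, h1, h2, h3⟩ := aux_ann h (Set.range fun a => r * a)
  have h3' : ∀ x, (∀ a, r * a * x = 0) ↔ n * x = x := by
    intro x; rw [← h3 x]; simp
  refine ⟨n, ⟨⟨h1, h2⟩, ?_⟩, h3'⟩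
  have key : ∀ b, n * (b * n) = b * n := by
    intro b
    apply (h3' _).1
    intro a
    have := (h3' n).2 h2 (a * b)
    simpa [mul_assoc] using this
  intro b
  exact aux_comm_s1 h1 (key b) (key (star b))

lemma aux_sup (h : IsAWStarRing R) (S : Set R) (hS : ∀ p ∈ S, star p = p) :
    ∃ s : R, star s = s ∧ s * s = s ∧ (∀ p ∈ S, p * s = p) ∧ (∀ p ∈ S, s * p = p) ∧
      (∀ x, (∀ p ∈ S, p * x = 0) → s * x = 0) ∧
      (∀ b, (∀ p ∈ S, p * b = b * p) → (∀ p ∈ S, p * star b = star b * p) → s * b = b * s) := by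
  obtain ⟨n, h1, h2, h3⟩ := aux_ann h S
  have h0 : ∀ s ∈ S, s * n = 0 := (h3 n).2 h2
  have ha : ∀ p ∈ S, p * (1 - n) = p := by
    intro p hp; rw [mul_sub, h0 p hp]; simp
  refine ⟨1 - n, by simp [h1], by simp [mul_sub, sub_mul, h2], ha, ?_, ?_, ?_⟩
  · intro p hp
    have := congrArg star (ha p hp)
    simpa [hS p hp, h1] using this
  · intro x hx
    rw [sub_mul, (h3 x).1 hx]; simp
  · intro b hb hb'
    rw [sub_mul, mul_sub, aux_ann_comm h1 h2 h3 b hb hb']; simp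

end Abstract

lemma aux_polar {A : Type u} [CStarAlgebra A] (h : IsAWStarRing A) (x q r : A) (hx : x ≠ 0)
    (hq : q * x = x) (hr : x * r = x) :
    ∃ w e : A, star w * w = e ∧ w * e = w ∧ e * e = e ∧ star e = e ∧ e ≠ 0 ∧ q * w = w ∧
      w * r = w := by
  set t := star x * x with ht
  have hts : IsSelfAdjoint t := IsSelfAdjoint.star_mul_self x
  have ht0 : t ≠ 0 := by
    intro h0; exact hx (CStarRing.star_mul_self_eq_zero_iff x |>.1 h0)
  obtain ⟨l, hl, hl0⟩ : ∃ l ∈ spectrum ℝ t, l ≠ 0 := by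
    by_contra hcon
    push Not at hcon
    exact ht0 (CFC.eq_zero_of_spectrum_subset_zero (R := ℝ) t (fun y hy => hcon y hy))
  have hlpos : 0 < l := lt_of_le_of_ne (spectrum_star_mul_self_nonneg l hl) (Ne.symm hl0)
  set c := l / 2 with hc
  have hcpos : 0 < c := by positivity
  have hmpos : ∀ s : ℝ, 0 < max s c := fun s => lt_max_of_lt_right hcpos
  set f : ℝ → ℝ := fun s => max (s - c) 0 with hf
  set κ : ℝ → ℝ := fun s => (Real.sqrt (max s c))⁻¹ with hκ
  set μ : ℝ → ℝ := fun s => max (s - c) 0 * (max s c)⁻¹ with hμ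
  have cf : Continuous f := by fun_prop
  have cκ : Continuous κ := by
    apply Continuous.inv₀ (by fun_prop)
    intro s; exact (Real.sqrt_pos.2 (hmpos s)).ne'
  have cμ : Continuous μ := by
    apply Continuous.mul (by fun_prop)
    exact Continuous.inv₀ (by fun_prop) (fun s => (hmpos s).ne')
  set a := cfc f t with ha
  set k := cfc κ t with hk
  have ha0 : a ≠ 0 := by
    intro h0
    have hm := cfc_map_spectrum (R := ℝ) f t hts cf.continuousOn
    have : f l ∈ spectrum ℝ (cfc f t) := by rw [hm]; exact ⟨l, hl, rfl⟩
    rw [← ha, h0] at this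
    have hnt : Nontrivial A := ⟨⟨x, 0, hx⟩⟩
    rw [spectrum.zero_eq] at this
    have h2 : max (l - c) 0 = 0 := this
    have h3 : l - c ≤ 0 := by rw [← h2]; exact le_max_left _ _
    linarith
  have haa : star a = a := (cfc_predicate (R := ℝ) f t : IsSelfAdjoint _)
  have hkk : star k = k := (cfc_predicate (R := ℝ) κ t : IsSelfAdjoint _)
  have hat : a * t = t * a := ((Commute.refl t).cfc_real f)
  have hkt : k * t = t * k := ((Commute.refl t).cfc_real κ)
  have hak : a * k = k * a := by
    have : Commute k a := Commute.cfc_real (Commute.symm (Commute.cfc_real (Commute.refl t) f)) κ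
    exact this.symm
  have hid : cfc (fun s : ℝ => s) t = t := cfc_id' ℝ t
  have e1 : a * (t * k * k) = a := by
    have : a * (t * k * k) = cfc (fun s => f s * (s * κ s * κ s)) t := by
      rw [cfc_mul f (fun s => s * κ s * κ s) t cf.continuousOn (by fun_prop),
        cfc_mul (fun s => s * κ s) κ t (by fun_prop) cκ.continuousOn,
        cfc_mul (fun s => s) κ t (by fun_prop) cκ.continuousOn, hid]
    rw [this]
    apply cfc_congr
    intro s _
    simp only [hf, hκ]
    rcases le_total s c with h1 | h1
    · rw [max_eq_right (by linarith : s - c ≤ 0)]; simp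
    · have hs : 0 < s := lt_of_lt_of_le hcpos h1
      rw [max_eq_left h1, mul_assoc s, ← mul_inv, Real.mul_self_sqrt hs.le, mul_inv_cancel₀ hs.ne',
        mul_one]
  have e2 : a = cfc μ t * t := by
    have : cfc μ t * t = cfc (fun s => μ s * s) t := by
      rw [cfc_mul μ (fun s => s) t cμ.continuousOn (by fun_prop), hid]
    rw [this]
    apply cfc_congr
    intro s _
    simp only [hf, hμ]
    rcases le_total s c with h1 | h1
    · rw [max_eq_right (by linarith : s - c ≤ 0)]; simp
    · have hs : 0 < s := lt_of_lt_of_le hcpos h1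
      rw [max_eq_left h1, mul_assoc, inv_mul_cancel₀ hs.ne', mul_one]
  obtain ⟨n, n1, n2, n3⟩ := aux_ann h {a}
  have n4 : a * n = 0 := (n3 n).2 n2 a rfl
  have n5 : ∀ y, a * y = 0 → n * y = y := by
    intro y hy; apply (n3 y).1; rintro s rfl; exact hy
  have nt : n * t = t * n := by
    apply aux_ann_comm n1 n2 n3
    · rintro s rfl; exact hat
    · rintro s rfl; rw [hts.star_eq]; exact hat
  have nk : n * k = k * n := by
    apply aux_ann_comm n1 n2 n3
    · rintro s rfl; exact hak
    · rintro s rfl; rw [hkk]; exact hak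
  have f1 : n * (t * k * k - 1) = t * k * k - 1 := n5 _ (by rw [mul_sub, e1]; simp)
  have f2 : n * (1 - r) = 1 - r := by
    apply n5
    rw [e2, mul_assoc, ht, mul_assoc, mul_sub, hr]; simp
  set e := 1 - n with he
  have ee : e * e = e := by simp [he, mul_sub, sub_mul, n2]
  have es : star e = e := by simp [he, n1]
  have ek : e * k = k * e := by simp [he, mul_sub, sub_mul, nk]
  have et : e * (t * k * k) = e := by
    have : e * (t * k * k - 1) = 0 := by rw [he, sub_mul, f1]; simp
    rw [mul_sub, mul_one] at this
    exact sub_eq_zero.1 this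
  have er : e * r = e := by
    have : e * (1 - r) = 0 := by rw [he, sub_mul, f2]; simp
    rw [mul_sub, mul_one] at this
    exact (sub_eq_zero.1 this).symm
  refine ⟨x * k * e, e, ?_, ?_, ee, es, ?_, ?_, ?_⟩
  · simp only [star_mul, hkk, es]
    calc e * (k * star x) * (x * k * e) = e * (k * t * k) * e := by simp only [ht, mul_assoc]
      _ = e * (t * k * k) * e := by rw [hkt]
      _ = e := by rw [et, ee]
  · rw [mul_assoc, ee]
  · intro h0
    apply ha0
    have : n = 1 := by rw [he] at h0; exact (sub_eq_zero.1 h0).symm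
    rw [this, mul_one] at n4
    exact n4
  · rw [← mul_assoc, ← mul_assoc, hq]
  · rw [mul_assoc, er]

lemma aux_halve {A : Type u} [CStarAlgebra A] (h : IsAWStarRing A) (m : A) (hm : star m = m)
    (ε : ℝ) (hε : ‖m‖ ≤ ε) :
    ∃ n a : A, star n = n ∧ n * n = n ∧ ‖a - ((ε / 2 : ℝ) : ℂ) • (1 : A)‖ ≤ ε / 2 ∧
      m = (1 - 2 * n) * a ∧
      ∀ b, m * b = b * m → m * star b = star b * m → n * b = b * n := by
  have hms : IsSelfAdjoint m := hm
  have hε0 : 0 ≤ ε := (norm_nonneg _).trans hε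
  set f : ℝ → ℝ := fun s => max s 0 with hf
  set g : ℝ → ℝ := fun s => max (-s) 0 with hg
  have cf : Continuous f := by fun_prop
  have cg : Continuous g := by fun_prop
  set P := cfc f m with hP
  set N := cfc g m with hN
  have PN : P * N = 0 := by
    rw [hP, hN, ← cfc_mul f g m cf.continuousOn cg.continuousOn]
    rw [← cfc_zero ℝ m]
    apply cfc_congr
    intro s _
    simp only [hf, hg]
    rcases le_total s 0 with h1 | h1
    · rw [max_eq_right h1]; simp
    · rw [max_eq_right (by linarith : -s ≤ 0)]; simp
  have hsub : m = P - N := by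
    rw [hP, hN, ← cfc_sub f g m cf.continuousOn cg.continuousOn]
    conv_lhs => rw [← cfc_id' ℝ m]
    apply cfc_congr
    intro s _
    simp only [hf, hg]
    rcases le_total s 0 with h1 | h1
    · rw [max_eq_right h1, max_eq_left (by linarith : 0 ≤ -s)]; simp
    · rw [max_eq_left h1, max_eq_right (by linarith : -s ≤ 0)]; simp
  have hPs : star P = P := (cfc_predicate (R := ℝ) f m : IsSelfAdjoint _)
  obtain ⟨n, n1, n2, n3⟩ := aux_ann h {P}
  have n4 : P * n = 0 := (n3 n).2 n2 P rfl
  have n4' : n * P = 0 := by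
    have := congrArg star n4
    simpa [hPs, n1] using this
  have n5 : n * N = N := by apply (n3 _).1; rintro s rfl; exact PN
  refine ⟨n, P + N, n1, n2, ?_, ?_, ?_⟩
  · have h1 : P + N - ((ε / 2 : ℝ) : ℂ) • (1 : A) = cfc (fun s => f s + g s - ε / 2) m := by
      rw [cfc_sub (fun s => f s + g s) (fun _ => ε / 2) m (by fun_prop) (by fun_prop),
        cfc_add m f g cf.continuousOn cg.continuousOn, cfc_const (ε / 2) m hms]
      congr 1
      rw [Algebra.algebraMap_eq_smul_one]
      exact Complex.coe_smul _ _
    rw [h1]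
    apply norm_cfc_le (by positivity)
    intro s hs
    have hnt : Nontrivial A := by
      by_contra hnt
      have hsub := not_nontrivial_iff_subsingleton.1 hnt
      simp [spectrum.of_subsingleton] at hs
    have h2 : |s| ≤ ε := (spectrum.norm_le_norm_of_mem hs).trans hε
    have h3 : f s + g s = |s| := by
      simp only [hf, hg]
      rcases le_total s 0 with h1 | h1
      · rw [max_eq_right h1, max_eq_left (by linarith : 0 ≤ -s), abs_of_nonpos h1]; simp
      · rw [max_eq_left h1, max_eq_right (by linarith : -s ≤ 0), abs_of_nonneg h1]; simp
    rw [h3, Real.norm_eq_abs, abs_le]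
    have := abs_nonneg s
    constructor <;> linarith
  · rw [sub_mul, mul_assoc, mul_add n, n4', n5, hsub]
    noncomm_ring
  · intro b hb hb'
    apply aux_ann_comm n1 n2 n3
    · rintro s rfl; exact (Commute.cfc_real hb f)
    · rintro s rfl; exact (Commute.cfc_real hb' f)

lemma aux_masa {A : Type u} [Ring A] [StarRing A] [Algebra ℂ A] [StarModule ℂ A]
    {M : StarSubalgebra ℂ A} (hM : IsMaximalAbelian M) (b : A) (hb : star b = b)
    (hc : ∀ m ∈ M, m * b = b * m) : b ∈ M := by
  have hcom : ∀ x ∈ insert b (M : Set A), ∀ y ∈ insert b (M : Set A), x * y = y * x := by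
    rintro x (rfl | hx) y (rfl | hy)
    · rfl
    · exact (hc y hy).symm
    · exact hc x hx
    · exact hM.1 x hx y hy
  have hstar : ∀ y ∈ insert b (M : Set A), star y ∈ insert b (M : Set A) := by
    rintro y (rfl | hy)
    · rw [hb]; exact Set.mem_insert _ _
    · exact Set.mem_insert_of_mem _ (star_mem (S := StarSubalgebra ℂ A) hy)
  have hcomm := StarAlgebra.isMulCommutative_adjoin ℂ hcom
    (fun x hx y hy => hcom x hx _ (hstar y hy))
  have hsub := StarAlgebra.subset_adjoin ℂ (insert b (M : Set A))
  have := hM.2 (StarAlgebra.adjoin ℂ (insert b (M : Set A)))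
    (by
      intro x hx y hy
      exact congrArg Subtype.val (hcomm.is_comm.comm ⟨x, hx⟩ ⟨y, hy⟩))
    (fun m hm => hsub (Set.mem_insert_of_mem _ hm))
  rw [this]
  exact hsub (Set.mem_insert _ _)

lemma aux_norm {A : Type u} [CStarAlgebra A] {p : A} (h1 : star p = p) (h2 : p * p = p) :
    ‖p‖ ≤ 1 := by
  have h := CStarRing.norm_star_mul_self (x := p)
  rw [h1, h2] at h
  by_contra hc
  push Not at hc
  nlinarith

lemma aux_norm' {A : Type u} [CStarAlgebra A] {v p : A} (h1 : star p = p) (h2 : p * p = p)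
    (hv : star v * v = p) : ‖v‖ ≤ 1 := by
  have h := CStarRing.norm_star_mul_self (x := v)
  rw [hv] at h
  have := aux_norm h1 h2
  by_contra hc
  push Not at hc
  nlinarith

lemma aux_central {A : Type u} [CStarAlgebra A] (h : IsAWStarRing A)
    {M : StarSubalgebra ℂ A} (hM : IsMaximalAbelian M) {z : A} (hz : IsCentralProj z)
    (hp : ∀ p ∈ M, IsProjection p → ∀ b, z * p * b = b * (z * p)) (b : A) (k : ℕ) :
    ∀ m ∈ M, star m = m → z * m = m → ∀ ε : ℝ, ‖m‖ ≤ ε →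
      ‖m * b - b * m‖ ≤ 2 * ε * ‖b‖ / 2 ^ k := by
  induction k with
  | zero =>
    intro m _ _ _ ε hε
    have h1 := norm_sub_le (m * b) (b * m)
    have h2 := norm_mul_le m b
    have h3 := norm_mul_le b m
    have h4 := mul_le_mul_of_nonneg_right hε (norm_nonneg b)
    simp only [pow_zero, div_one]
    nlinarith
  | succ k ih =>
    intro m hm hms hzm ε hε
    obtain ⟨n, a, n1, n2, ha, hma, hn⟩ := aux_halve h m hms ε hε
    have hzM : z ∈ M := aux_masa hM z hz.1.1 (fun m _ => (hz.2 m).symm)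
    have hnM : n ∈ M := by
      apply aux_masa hM n n1
      intro y hy
      exact (hn y (hM.1 _ hm _ hy) (hM.1 _ hm _ (star_mem hy))).symm
    have hzn := hp n hnM ⟨n1, n2⟩
    set c : ℂ := ((ε / 2 : ℝ) : ℂ) with hc
    set U := z * (1 - 2 * n) with hU
    have hUM : U ∈ M := by
      apply mul_mem hzM
      apply sub_mem (one_mem _)
      rw [two_mul]
      exact add_mem hnM hnM
    have hnz : n * z = z * n := (hz.2 n).symm
    have hUc : ∀ y, U * y = y * U := by
      intro y
      have e1 := hzn y
      have e2 := hz.2 y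
      have : U = z - 2 * (z * n) := by rw [hU]; noncomm_ring
      rw [this, sub_mul, mul_sub, e2, mul_assoc, e1]; noncomm_ring
    have hUs : star U = U := by
      simp only [hU, two_mul, star_mul, star_sub, star_add, star_one, n1, hz.1.1]
      rw [sub_mul, mul_sub, add_mul, mul_add, hnz]; simp
    have hUU : star U * U = z := by
      rw [hUs]
      have e1 : U * U = z * z * ((1 - 2 * n) * (1 - 2 * n)) := by
        rw [hU]
        have := hz.2 (1 - 2 * n)
        rw [mul_assoc z, ← mul_assoc _ z, ← this]
        simp only [mul_assoc]
      have e2 : (1 - 2 * n) * (1 - 2 * n) = 1 - 4 * n + 4 * (n * n) := by noncomm_ring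
      rw [e1, e2, n2, hz.1.2]; simp
    have hUn : ‖U‖ ≤ 1 := aux_norm' hz.1.1 hz.1.2 hUU
    have key : m - c • U = U * (a - c • (1 : A)) := by
      rw [mul_sub, mul_smul_comm, mul_one, hU, mul_assoc, ← hma, hzm]
    have hcs : star c = c := by simp [hc]
    have := ih (m - c • U) (sub_mem hm (SMulMemClass.smul_mem c hUM))
      (by rw [star_sub, star_smul, hms, hUs, hcs])
      (by rw [mul_sub, hzm, mul_smul_comm, hU, ← mul_assoc, hz.1.2]) (ε / 2)
      (by
        rw [key]
        refine (norm_mul_le _ _).trans ?_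
        calc ‖U‖ * ‖a - c • (1 : A)‖ ≤ 1 * (ε / 2) :=
              mul_le_mul hUn ha (norm_nonneg _) zero_le_one
          _ = ε / 2 := one_mul _)
    have e : (m - c • U) * b - b * (m - c • U) = m * b - b * m := by
      rw [sub_mul, mul_sub, smul_mul_assoc, mul_smul_comm, hUc b]; abel
    rw [e] at this
    refine this.trans (le_of_eq ?_)
    rw [pow_succ]; field_simp

lemma aux_noncentral {A : Type u} [CStarAlgebra A] (h : IsAWStarRing A)
    {M : StarSubalgebra ℂ A} (hM : IsMaximalAbelian M) {z : A} (hz : IsCentralProj z)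
    (hna : ∃ a b : A, (z * a) * (z * b) ≠ (z * b) * (z * a)) :
    ∃ p ∈ M, IsProjection p ∧ ∃ b, z * p * b ≠ b * (z * p) := by
  by_contra hcon
  push Not at hcon
  have hsa : ∀ m ∈ M, star m = m → z * m = m → ∀ b, m * b = b * m := by
    intro m hm hms hzm b
    have h1 := fun k => aux_central h hM hz hcon b k m hm hms hzm ‖m‖ le_rfl
    have h2 : Filter.Tendsto (fun k : ℕ => 2 * ‖m‖ * ‖b‖ / 2 ^ k) Filter.atTop (nhds 0) :=
      tendsto_const_nhds.div_atTop (tendsto_pow_atTop_atTop_of_one_lt (by norm_num))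
    have h3 : ‖m * b - b * m‖ ≤ 0 := ge_of_tendsto' h2 h1
    exact sub_eq_zero.1 (norm_le_zero_iff.1 h3)
  have hzM : z ∈ M := aux_masa hM z hz.1.1 (fun m _ => (hz.2 m).symm)
  -- every element of zM is central
  have hsplit : ∀ (y : A), ∃ y1 y2 : A, star y1 = y1 ∧ star y2 = y2 ∧
      y = y1 + Complex.I • y2 ∧ (y ∈ M → y1 ∈ M ∧ y2 ∈ M) := by
    intro y
    refine ⟨(realPart y : A), (imaginaryPart y : A), (realPart y).2, (imaginaryPart y).2,
      (realPart_add_I_smul_imaginaryPart y).symm, fun hy => ⟨?_, ?_⟩⟩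
    · rw [realPart_apply_coe, ← Complex.coe_smul]
      exact SMulMemClass.smul_mem _ (add_mem hy (star_mem hy))
    · rw [imaginaryPart_apply_coe, ← Complex.coe_smul]
      exact SMulMemClass.smul_mem _ (SMulMemClass.smul_mem _ (sub_mem hy (star_mem hy)))
  have hzs : ∀ m, star m = m → star (z * m) = z * m := by
    intro m hm
    rw [star_mul, hm, hz.1.1, hz.2]
  have hcen : ∀ m ∈ M, star m = m → ∀ b, z * m * b = b * (z * m) := by
    intro m hm hms b
    exact hsa (z * m) (mul_mem hzM hm) (hzs m hms) (by rw [← mul_assoc, hz.1.2]) b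
  have hcen' : ∀ m ∈ M, ∀ b, z * m * b = b * (z * m) := by
    intro m hm b
    obtain ⟨y1, y2, h1, h2, h3, h4⟩ := hsplit m
    obtain ⟨h5, h6⟩ := h4 hm
    rw [h3]
    have e1 := hcen y1 h5 h1 b
    have e2 := hcen y2 h6 h2 b
    rw [mul_add, add_mul, mul_add, e1, mul_smul_comm, smul_mul_assoc, e2, mul_smul_comm]
  have hin : ∀ x : A, star x = x → z * x ∈ M := by
    intro x hx
    apply aux_masa hM _ (hzs x hx)
    intro m hm
    have := hcen' m hm x
    rw [← mul_assoc, ← hz.2 m, this, hz.2 x, mul_assoc]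
  have hin' : ∀ x : A, z * x ∈ M := by
    intro x
    obtain ⟨y1, y2, h1, h2, h3, _⟩ := hsplit x
    rw [h3, mul_add, mul_smul_comm]
    exact add_mem (hin _ h1) (SMulMemClass.smul_mem _ (hin _ h2))
  obtain ⟨a, b, hab⟩ := hna
  exact hab (hM.1 _ (hin' a) _ (hin' b))

def AuxGood {A : Type u} [Ring A] [StarRing A] [Algebra ℂ A] [StarModule ℂ A]
    (M : StarSubalgebra ℂ A) (w p : A) : Prop :=
  p ∈ M ∧ IsProjection p ∧ w * p = p ∧
    ∀ v, IsCentralProj v → (v * p = 0 → v * w = 0) ∧ (v * (w - p) = 0 → v * w = 0)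

lemma aux_good {A : Type u} [CStarAlgebra A] (h : IsAWStarRing A)
    {M : StarSubalgebra ℂ A} (hM : IsMaximalAbelian M) {y : A} (hy : IsCentralProj y)
    (hna : ∃ a b : A, (y * a) * (y * b) ≠ (y * b) * (y * a)) :
    ∃ w, IsCentralProj w ∧ w ≠ 0 ∧ y * w = w ∧ ∃ p, AuxGood M w p := by
  obtain ⟨p, hpM, hp, b, hb⟩ := aux_noncentral h hM hy hna
  obtain ⟨d1, ⟨⟨d1s, d1i⟩, d1c⟩, hd1⟩ := aux_cann h (y * p)
  obtain ⟨d2, ⟨⟨d2s, d2i⟩, d2c⟩, hd2⟩ := aux_cann h (y * (1 - p))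
  have k1 : ∀ a, y * p * a * d1 = 0 := (hd1 d1).2 d1i
  have k2 : ∀ a, y * (1 - p) * a * d2 = 0 := (hd2 d2).2 d2i
  have d1y : d1 * (1 - y) = 1 - y := by
    apply (hd1 _).1
    intro a
    have : y * (1 - y) = 0 := by rw [mul_sub, hy.1.2]; simp
    rw [mul_sub, mul_one, ← hy.2 (y * p * a), ← mul_assoc, ← mul_assoc, hy.1.2]; simp
  set w := (1 - d1) * (1 - d2) with hw
  have wc : ∀ a, w * a = a * w := by
    intro a
    rw [hw, mul_assoc]
    have e1 : (1 - d2) * a = a * (1 - d2) := by rw [sub_mul, mul_sub, d2c]; simp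
    have e2 : (1 - d1) * a = a * (1 - d1) := by rw [sub_mul, mul_sub, d1c]; simp
    rw [e1, ← mul_assoc, e2, mul_assoc]
  have ws : star w = w := by
    rw [hw, star_mul]; simp only [star_sub, star_one, d1s, d2s]
    rw [sub_mul, mul_sub, mul_sub, mul_sub, sub_mul, sub_mul, d1c d2]; simp
  have wd1 : w * d1 = 0 := by
    have : d1 * (1 - d1) = 0 := by rw [mul_sub, d1i]; simp
    rw [wc, hw, ← mul_assoc, this, zero_mul]
  have wd2 : w * d2 = 0 := by
    have : (1 - d2) * d2 = 0 := by rw [sub_mul, d2i]; simp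
    rw [hw, mul_assoc, this, mul_zero]
  have ww : w * w = w := by
    have : w * ((1 - d1) * (1 - d2)) = w := by
      have : w * (1 - d1) = w := by rw [mul_sub, wd1]; simp
      rw [← mul_assoc, this, mul_sub, wd2]; simp
    rwa [← hw] at this
  have wy : y * w = w := by
    have : (1 - y) * w = 0 := by
      rw [← wc, ← d1y, ← mul_assoc, wd1, zero_mul]
    rw [sub_mul, one_mul] at this
    exact (sub_eq_zero.1 this).symm
  have hwM : w ∈ M := aux_masa hM w ws (fun m _ => (wc m).symm)
  refine ⟨w, ⟨⟨ws, ww⟩, wc⟩, ?_, wy, w * p, mul_mem hwM hpM, ⟨?_, ?_⟩, ?_, ?_⟩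
  · intro w0
    apply hb
    -- y p a y (1-p) = 0
    have key : ∀ a, y * p * a * (y * (1 - p)) = 0 := by
      intro a
      have e1 : y * p * a = y * p * a * (1 - d1) := by rw [mul_sub, k1]; simp
      have e2 : y * (1 - p) = (1 - d2) * (y * (1 - p)) := by
        have := k2 1
        rw [mul_one, ← d2c] at this
        rw [sub_mul, this]; simp
      calc y * p * a * (y * (1 - p)) = y * p * a * (1 - d1) * ((1 - d2) * (y * (1 - p))) := by
            rw [← e1, ← e2]
        _ = y * p * a * ((1 - d1) * (1 - d2)) * (y * (1 - p)) := by simp only [mul_assoc]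
        _ = 0 := by rw [← hw, w0]; simp
    have hyp : p * y = y * p := (hy.2 p).symm
    have key1 : ∀ a, y * p * a = y * p * a * p := by
      intro a
      have := key a
      rw [← mul_assoc, ← hy.2 (y * p * a), ← mul_assoc, ← mul_assoc, hy.1.2, mul_sub,
        mul_one] at this
      exact sub_eq_zero.1 this
    have key2 : ∀ a, a * (y * p) = p * a * (y * p) := by
      intro a
      have := congrArg star (key1 (star a))
      simp only [star_mul, star_star, hp.1, hy.1.1, hyp] at this
      simpa [mul_assoc] using this
    rw [key1 b, key2 b, hy.2 p]
    rw [mul_assoc p y b, hy.2 b, hyp]; simp only [mul_assoc]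
  · rw [star_mul, hp.1, ws, wc]
  · rw [mul_assoc, ← mul_assoc p, ← wc p, mul_assoc w p p, hp.2, ← mul_assoc, ww]
  · rw [← mul_assoc, ww]
  · intro v hv
    have hvw : ∀ a, v * w * a = a * (v * w) := by
      intro a; rw [mul_assoc, wc, ← mul_assoc, hv.2, mul_assoc]
    have fin1 : d1 * (v * w) = v * w → v * w = 0 := by
      intro hh; rw [← hh, ← hvw, mul_assoc, wd1, mul_zero]
    have fin2 : d2 * (v * w) = v * w → v * w = 0 := by
      intro hh; rw [← hh, ← hvw, mul_assoc, wd2, mul_zero]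
    constructor
    · intro h0
      apply fin1
      apply (hd1 _).1
      intro a
      rw [← hvw, ← mul_assoc, hy.2 p, ← mul_assoc, mul_assoc v w p, h0]; simp
    · intro h0
      apply fin2
      apply (hd2 _).1
      intro a
      have h0' : v * w * (1 - p) = 0 := by
        rw [mul_assoc, mul_sub, mul_one]; exact h0
      rw [← hvw, ← mul_assoc, hy.2 (1 - p), ← mul_assoc, h0']; simp

lemma aux_glob {A : Type u} [CStarAlgebra A] (h : IsAWStarRing A)
    {M : StarSubalgebra ℂ A} (hM : IsMaximalAbelian M)
    (hna : ∀ z : A, IsCentralProj z → z ≠ 0 →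
      ∃ a b : A, (z * a) * (z * b) ≠ (z * b) * (z * a)) :
    ∃ p ∈ M, IsProjection p ∧ ∀ y, IsCentralProj y →
      (y * p = 0 → y = 0) ∧ (y * (1 - p) = 0 → y = 0) := by
  let T : Set A := {w | IsCentralProj w ∧ w ≠ 0 ∧ ∃ p, AuxGood M w p}
  obtain ⟨S, hS⟩ := zorn_subset {S : Set A | S ⊆ T ∧ S.Pairwise (fun a b => a * b = 0)} (by
    intro c hc hchain
    refine ⟨⋃₀ c, ⟨Set.sUnion_subset fun s hs => (hc hs).1, ?_⟩,
      fun s hs => Set.subset_sUnion_of_mem hs⟩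
    rw [Set.pairwise_sUnion hchain.directedOn]
    exact fun s hs => (hc hs).2)
  obtain ⟨⟨hST, hSp⟩, hmax⟩ := hS
  have hex : ∀ w : A, ∃ p, w ∈ S → AuxGood M w p := by
    intro w
    by_cases hw : w ∈ S
    · obtain ⟨p, hp⟩ := (hST hw).2.2
      exact ⟨p, fun _ => hp⟩
    · exact ⟨0, fun h => absurd h hw⟩
  choose P hP using hex
  obtain ⟨s, s1, s2, s3, s4, s5, s6⟩ := aux_sup h (P '' S) (by
    rintro _ ⟨w, hw, rfl⟩; exact (hP w hw).2.1.1)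
  have hsM : s ∈ M := by
    apply aux_masa hM s s1
    intro m hm
    refine (s6 m ?_ ?_).symm
    · rintro _ ⟨w, hw, rfl⟩; exact hM.1 _ (hP w hw).1 _ hm
    · rintro _ ⟨w, hw, rfl⟩; exact hM.1 _ (hP w hw).1 _ (star_mem hm)
  have hws : ∀ w ∈ S, w * s = P w := by
    intro w hw
    have hwc := (hST hw).1
    have g := hP w hw
    have e0 : P w * w = P w := by rw [← hwc.2, g.2.2.1]
    have e1 : s * (w - P w) = 0 := by
      apply s5
      rintro _ ⟨w', hw', rfl⟩
      by_cases hww : w = w'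
      · subst hww
        rw [mul_sub, e0, g.2.1.2, sub_self]
      · have g' := hP w' hw'
        have hwc' := (hST hw').1
        have z1 : w' * w = 0 := hSp hw' hw (Ne.symm hww)
        have e2 : P w' * w' = P w' := by rw [← hwc'.2, g'.2.2.1]
        rw [← g.2.2.1, ← e2, mul_sub, mul_assoc, z1, mul_assoc, ← mul_assoc w', z1]; simp
    rw [mul_sub, s4 _ ⟨w, hw, rfl⟩, ← hwc.2] at e1
    exact sub_eq_zero.1 e1
  have horth : ∀ y, IsCentralProj y → (∀ w ∈ S, y * w = 0) → y = 0 := by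
    intro y hy hyS
    by_contra hy0
    obtain ⟨w, wc, w0, hyw, hg⟩ := aux_good h hM hy (hna y hy hy0)
    have hw1 : ∀ v ∈ S, w * v = 0 := by
      intro v hv
      rw [← hyw, hy.2, mul_assoc, hyS v hv, mul_zero]
    have : insert w S ⊆ S := by
      apply hmax
      · refine ⟨Set.insert_subset ⟨wc, w0, hg⟩ hST, ?_⟩
        apply hSp.insert
        intro v hv _
        exact ⟨hw1 v hv, by rw [← wc.2]; exact hw1 v hv⟩
      · exact Set.subset_insert _ _
    have hwS : w ∈ S := this (Set.mem_insert _ _)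
    apply w0
    rw [← wc.1.2]
    exact hw1 w hwS
  refine ⟨s, hsM, ⟨s1, s2⟩, fun y hy => ⟨fun h0 => ?_, fun h0 => ?_⟩⟩
  · apply horth y hy
    intro w hw
    apply (((hP w hw).2.2.2 y hy).1)
    rw [← hws w hw, ← mul_assoc, hy.2 w, mul_assoc, h0, mul_zero]
  · apply horth y hy
    intro w hw
    apply (((hP w hw).2.2.2 y hy).2)
    have : w - P w = w * (1 - s) := by rw [mul_sub, hws w hw, mul_one]
    rw [this, ← mul_assoc, hy.2 w, mul_assoc, h0, mul_zero]

lemma aux_max {A : Type u} [CStarAlgebra A] (h : IsAWStarRing A) (p : A) (hp : IsProjection p) :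
    ∃ g : A, star g = g ∧ g * g = g ∧ g * (2 * p - 1) * g = 0 ∧
      ∀ a, (p - 2 * (p * g * p)) * a * (1 - p - 2 * ((1 - p) * g * (1 - p))) = 0 := by
  obtain ⟨ps, pp⟩ := hp
  set s := 2 * p - 1 with hs
  have ss : star s = s := by simp [hs, two_mul, ps]
  let G := {g : A // star g = g ∧ g * g = g ∧ g * s * g = 0}
  obtain ⟨⟨g, gs, gg, gsg⟩, hmax⟩ :=
    exists_maximal_of_chains_bounded (α := G) (r := fun a b => a.1 * b.1 = a.1) (by
      intro c hc
      obtain ⟨t, t1, t2, t3, t4, t5, t6⟩ := aux_sup h (Subtype.val '' c) (by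
        rintro _ ⟨⟨g, hg⟩, _, rfl⟩; exact hg.1)
      have k1 : ∀ a ∈ c, ∀ b ∈ c, a.1 * s * b.1 = 0 := by
        intro a ha b hb
        by_cases hab : a = b
        · subst hab; exact a.2.2.2
        · rcases hc ha hb hab with h1 | h1
          · rw [← h1, mul_assoc, mul_assoc, ← mul_assoc b.1, b.2.2.2, mul_zero]
          · have h2 := congrArg star h1
            rw [star_mul, a.2.1, b.2.1] at h2
            rw [← h2, ← mul_assoc, a.2.2.2, zero_mul]
      have k2 : ∀ b ∈ c, t * (s * b.1) = 0 := by
        intro b hb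
        apply t5
        rintro _ ⟨a, ha, rfl⟩
        rw [← mul_assoc]; exact k1 a ha b hb
      have k3 : t * (s * t) = 0 := by
        apply t5
        rintro _ ⟨b, hb, rfl⟩
        have := congrArg star (k2 b hb)
        simp only [star_mul, b.2.1, t1, ss, star_zero] at this
        rw [← mul_assoc]; exact this
      refine ⟨⟨t, t1, t2, by rw [mul_assoc]; exact k3⟩, fun a ha => t3 _ ⟨a, ha, rfl⟩⟩)
    (by
      intro a b c h1 h2
      rw [← h1, mul_assoc, h2])
  refine ⟨g, gs, gg, gsg, ?_⟩
  have gpg : 2 * (g * p * g) = g := by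
    have : g * s * g = 2 * (g * p * g) - g * g := by rw [hs]; noncomm_ring
    rw [gsg, gg] at this
    exact (sub_eq_zero.1 this.symm)
  have gqg : 2 * (g * (1 - p) * g) = g := by
    have : 2 * (g * (1 - p) * g) = 2 * (g * g) - 2 * (g * p * g) := by noncomm_ring
    rw [this, gpg, gg]; noncomm_ring
  intro a
  by_contra hx
  set q := p - 2 * (p * g * p) with hq
  set r := 1 - p - 2 * ((1 - p) * g * (1 - p)) with hr
  have QQ : (1 - p) * (1 - p) = 1 - p := by simp [mul_sub, sub_mul, pp]
  have pq : p * q = q := by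
    rw [hq, mul_sub, pp]
    congr 1
    have : p * (2 * (p * g * p)) = 2 * ((p * p) * g * p) := by noncomm_ring
    rw [this, pp]
  have rp : r * p = 0 := by
    have : r * p = (p - p * p) - 2 * ((1 - p) * g * (p - p * p)) := by rw [hr]; noncomm_ring
    rw [this, pp]; simp
  have g_q : g * q = 0 := by
    have : g * q = g * p - 2 * (g * p * g) * p := by rw [hq]; noncomm_ring
    rw [this, gpg]; simp
  have r_g : r * g = 0 := by
    have : r * g = (1 - p) * g - (1 - p) * (2 * (g * (1 - p) * g)) := by rw [hr]; noncomm_ring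
    rw [this, gqg]; simp
  have q2 : q * q = q := by
    have : q * q = p * q - 2 * (p * (g * (p * q))) := by
      calc q * q = (p - 2 * (p * g * p)) * q := by rw [← hq]
        _ = _ := by noncomm_ring
    rw [this, pq, g_q]; simp
  have r1p : r * (1 - p) = r := by rw [mul_sub, rp]; simp
  have r2 : r * r = r := by
    have : r * r = r * (1 - p) - 2 * (r * (1 - p) * g * (1 - p)) := by
      calc r * r = r * (1 - p - 2 * ((1 - p) * g * (1 - p))) := by rw [← hr]
        _ = _ := by noncomm_ring
    rw [this, r1p, r_g]; simp
  obtain ⟨w, e, w1, w2, ee, es, e0, qw, wr⟩ := aux_polar h (q * a * r) q r hx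
    (by rw [← mul_assoc, ← mul_assoc, q2]) (by rw [mul_assoc, r2])
  have pw : p * w = w := by rw [← qw, ← mul_assoc, pq]
  have wp : w * p = 0 := by rw [← wr, mul_assoc, rp, mul_zero]
  have gw : g * w = 0 := by rw [← qw, ← mul_assoc, g_q, zero_mul]
  have wg : w * g = 0 := by rw [← wr, mul_assoc, r_g, mul_zero]
  have gw' : g * star w = 0 := by
    have := congrArg star wg; simpa [gs] using this
  have wp' : p * star w = 0 := by
    have := congrArg star wp; simpa [ps] using this
  have pw' : star w * p = star w := by
    have := congrArg star pw; simpa [ps] using this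
  have w2' : e * star w = star w := by
    have := congrArg star w2; simpa [es] using this
  have www : w * w = 0 := by
    calc w * w = w * (p * w) := by rw [pw]
      _ = 0 := by rw [← mul_assoc, wp, zero_mul]
  have www' : star w * star w = 0 := by rw [← star_mul, www, star_zero]
  set f := w * star w with hf
  have ew : e * w = 0 := by rw [← w1, mul_assoc, www, mul_zero]
  have we' : star w * e = 0 := by rw [← w1, ← mul_assoc, www', zero_mul]
  have fw : f * w = w := by rw [hf, mul_assoc, w1, w2]
  have wf : w * f = 0 := by rw [hf, ← mul_assoc, www, zero_mul]
  have w'f : star w * f = star w := by rw [hf, ← mul_assoc, w1, w2']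
  have fw' : f * star w = 0 := by rw [hf, mul_assoc, www', mul_zero]
  have ef : e * f = 0 := by rw [hf, ← mul_assoc, ew, zero_mul]
  have fe : f * e = 0 := by rw [hf, mul_assoc, we', mul_zero]
  have ff : f * f = f := by
    calc f * f = f * w * star w := by rw [mul_assoc f]
      _ = f := by rw [fw, ← hf]
  have fs : star f = f := by rw [hf]; simp
  have ge : g * e = 0 := by rw [← w1, ← mul_assoc, gw', zero_mul]
  have gf : g * f = 0 := by rw [hf, ← mul_assoc, gw, zero_mul]
  have pe : p * e = 0 := by rw [← w1, ← mul_assoc, wp', zero_mul]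
  have pf : p * f = f := by rw [hf, ← mul_assoc, pw]
  set H := e + f + w + star w with hH
  set K := -e + f + w - star w with hK
  have HH : H * H = 2 * H := by
    simp only [hH, mul_add, add_mul, ee, ef, ew, w2', fe, ff, fw, fw', w2, wf, www, we', w'f, w1,
      www', ← hf]
    noncomm_ring
  have sH : s * H = K := by
    have : s * H = 2 * (p * H) - H := by rw [hs]; noncomm_ring
    rw [this]
    simp only [hH, hK, mul_add, pe, pf, pw, wp']
    noncomm_ring
  have HK : H * K = 0 := by
    simp only [hH, hK, mul_add, mul_sub, mul_neg, add_mul, ee, ef, ew, w2', fe, ff, fw, fw', w2, wf,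
      www, we', w'f, w1, www', ← hf]
    noncomm_ring
  have Hs : star H = H := by
    simp only [hH, star_add, es, fs, star_star]; abel
  have gH : g * H = 0 := by simp [hH, mul_add, ge, gf, gw, gw']
  have gK : g * K = 0 := by simp [hK, mul_add, mul_sub, ge, gf, gw, gw']
  have Hg : H * g = 0 := by
    have := congrArg star gH; simpa [gs, Hs] using this
  have Hsg : H * s * g = 0 := by
    have := congrArg star gK
    rw [← sH] at this
    simpa [gs, Hs, ss] using this
  have HsH : H * s * H = 0 := by rw [mul_assoc, sH, HK]
  have gsH : g * s * H = 0 := by rw [mul_assoc, sH, gK]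
  let c : ℂ := 1 / 2
  have hc2 : c * c * 2 = c := by norm_num [c]
  have hcs : star c = c := by simp [c]
  let g' := g + c • H
  have hG : star g' = g' ∧ g' * g' = g' ∧ g' * s * g' = 0 := by
    refine ⟨?_, ?_, ?_⟩
    · simp only [g', star_add, star_smul, gs, Hs, hcs]
    · simp only [g', mul_add, add_mul, gg, mul_smul_comm, smul_mul_assoc, gH, Hg, HH, smul_zero,
        add_zero, zero_add]
      congr 1
      rw [two_mul, ← two_smul ℂ H, smul_smul, smul_smul, hc2]
    · simp only [g', mul_add, add_mul, gsg, mul_smul_comm, smul_mul_assoc, gsH, Hsg, HsH, smul_zero,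
        add_zero]
  have h1 := hmax ⟨g', hG⟩ (by
    change g * (g + c • H) = g
    rw [mul_add, gg, mul_smul_comm, gH, smul_zero, add_zero])
  change (g + c • H) * g = g + c • H at h1
  rw [add_mul, gg, smul_mul_assoc, Hg, smul_zero, add_zero] at h1
  have h2 : c • H = 0 := by
    have := sub_eq_zero.2 h1
    simpa using this
  have h3 : H = 0 := (smul_eq_zero.1 h2).resolve_left (by norm_num [c])
  apply e0
  have h4 : e * H * e = 0 := by rw [h3]; simp
  have h5 : e * H * e = e := by
    simp only [hH, mul_add, add_mul, ee, ef, ew, w2', we', zero_mul]; simp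
  rw [← h5, h4]

lemma aux_main {A : Type u} [CStarAlgebra A] (hAW : IsAWStarRing A)
    (hNoAbelian : ∀ z : A, IsCentralProj z → z ≠ 0 →
      ∃ a b : A, (z * a) * (z * b) ≠ (z * b) * (z * a))
    (M : StarSubalgebra ℂ A) (hM : IsMaximalAbelian M) :
    ∃ e : A, e ∈ M ∧ IsProjection e ∧ IsCentralCover e 1 ∧ IsCentralCover (1 - e) 1 ∧
      ProjSubEquiv e (1 - e) := by
  obtain ⟨p, hpM, hp, hfull⟩ := aux_glob hAW hM hNoAbelian
  obtain ⟨g, gs, gg, gsg, hg⟩ := aux_max hAW p hp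
  obtain ⟨ps, pp⟩ := hp
  have gpg : 2 * (g * p * g) = g := by
    have : g * (2 * p - 1) * g = 2 * (g * p * g) - g * g := by noncomm_ring
    rw [gsg, gg] at this
    exact (sub_eq_zero.1 this.symm)
  have gqg : 2 * (g * (1 - p) * g) = g := by
    have : 2 * (g * (1 - p) * g) = 2 * (g * g) - 2 * (g * p * g) := by noncomm_ring
    rw [this, gpg, gg]; noncomm_ring
  set P' := 1 - p with hP'
  have Ps : star P' = P' := by simp [hP', ps]
  have PP : P' * P' = P' := by simp [hP', mul_sub, sub_mul, pp]
  have pP : p * P' = 0 := by simp [hP', mul_sub, pp]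
  have Pp : P' * p = 0 := by simp [hP', sub_mul, pp]
  set E := 2 * (p * g * p) with hE
  set F := 2 * (P' * g * P') with hF
  set v := 2 * (P' * g * p) with hv
  have vs : star v = 2 * (p * g * P') := by
    simp only [hv, two_mul, star_add, star_mul, gs, ps, Ps, mul_assoc]
  have vv : star v * v = E := by
    rw [vs, hv, hE]
    have : 2 * (p * g * P') * (2 * (P' * g * p)) = 2 * (p * (2 * (g * (P' * P') * g)) * p) := by
      noncomm_ring
    rw [this, PP, gqg]
  have vv' : v * star v = F := by
    rw [vs, hv, hF]
    have : 2 * (P' * g * p) * (2 * (p * g * P')) = 2 * (P' * (2 * (g * (p * p) * g)) * P') := by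
      noncomm_ring
    rw [this, pp, gpg]
  have pE : p * E = E := by
    rw [hE]
    have : p * (2 * (p * g * p)) = 2 * ((p * p) * g * p) := by noncomm_ring
    rw [this, pp]
  have PF : P' * F = F := by
    rw [hF]
    have : P' * (2 * (P' * g * P')) = 2 * ((P' * P') * g * P') := by noncomm_ring
    rw [this, PP]
  have v_v : v * v = 0 := by
    have : v * v = 4 * (P' * g * (p * P') * g * p) := by rw [hv]; noncomm_ring
    rw [this, pP]; simp
  obtain ⟨z, hz, hzx⟩ := aux_cann hAW (p - E)
  have hzc := hz.2
  obtain ⟨⟨zs, zz⟩, -⟩ := hz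
  have hz1 : (p - E) * z = 0 := by
    have := (hzx z).2 zz 1; simpa using this
  have hz2 : z * (P' - F) = P' - F := (hzx _).1 hg
  -- on `z`: p = E ; off `z`: 1 - p = F
  set y := 1 - z with hy
  have yc : ∀ a, y * a = a * y := by intro a; simp [hy, sub_mul, mul_sub, hzc]
  have ys : star y = y := by simp [hy, zs]
  have yy : y * y = y := by simp [hy, mul_sub, sub_mul, zz]
  have zy : z * y = 0 := by simp [hy, mul_sub, zz]
  have yz : y * z = 0 := by simp [hy, sub_mul, zz]
  have zp : z * p = z * E := by
    rw [← hzc, mul_sub] at hz1; exact sub_eq_zero.1 hz1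
  have yP : y * P' = y * F := by
    have : y * (P' - F) = 0 := by rw [hy, sub_mul, hz2]; simp
    rw [mul_sub] at this; exact sub_eq_zero.1 this
  have hzM : z ∈ M := aux_masa hM z zs (fun m _ => (hzc m).symm)
  set e := z * p + y * P' with he
  have e1 : 1 - e = z * P' + y * p := by
    rw [he, hP', hy]; noncomm_ring
  have heM : e ∈ M := by
    refine add_mem (mul_mem hzM hpM) (mul_mem (sub_mem (one_mem _) hzM) (sub_mem (one_mem _) hpM))
  -- general product formula
  have prod : ∀ a b c d : A, (z * a + y * b) * (z * c + y * d) = z * (a * c) + y * (b * d) := by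
    intro a b c d
    have t1 : z * a * (z * c) = z * (a * c) := by
      rw [mul_assoc, ← mul_assoc a, ← hzc a, mul_assoc z a c, ← mul_assoc, zz]
    have t2 : z * a * (y * d) = 0 := by
      rw [mul_assoc, ← mul_assoc a, ← yc a, mul_assoc y a d, ← mul_assoc, zy, zero_mul]
    have t3 : y * b * (z * c) = 0 := by
      rw [mul_assoc, ← mul_assoc b, ← hzc b, mul_assoc z b c, ← mul_assoc, yz, zero_mul]
    have t4 : y * b * (y * d) = y * (b * d) := by
      rw [mul_assoc, ← mul_assoc b, ← yc b, mul_assoc y b d, ← mul_assoc, yy]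
    rw [add_mul, mul_add, mul_add, t1, t2, t3, t4]; simp
  have starf : ∀ a b : A, star (z * a + y * b) = z * star a + y * star b := by
    intro a b
    rw [star_add, star_mul, star_mul, zs, ys, ← hzc, ← yc]
  have heP : IsProjection e := by
    refine ⟨?_, ?_⟩
    · rw [he, starf, ps, Ps]
    · rw [he, prod, pp, PP]
  set W := z * v + y * star v with hW
  have hWs : star W = z * star v + y * v := by rw [hW, starf, star_star]
  have hW1 : star W * W = e := by
    rw [hWs, hW, prod, vv, vv', ← zp, ← yP]
  have hW2 : W * star W = z * F + y * E := by
    rw [hWs, hW, prod, vv, vv']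
  have Es : star E = E := by rw [← vv]; simp
  have Fs : star F = F := by rw [← vv']; simp
  have EE : E * E = E := by
    have : E * E = 2 * (p * (2 * (g * (p * p) * g)) * p) := by rw [hE]; noncomm_ring
    rw [this, pp, gpg]
  have FF : F * F = F := by
    have : F * F = 2 * (P' * (2 * (g * (P' * P') * g)) * P') := by rw [hF]; noncomm_ring
    rw [this, PP, gqg]
  have Ep : E * p = E := by have := congrArg star pE; simpa [ps, Es] using this
  have FP : F * P' = F := by
    have := congrArg star PF; rw [star_mul, Ps, Fs] at this; exact this
  have hsubE : ProjSubEquiv e (1 - e) := by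
    refine ⟨z * F + y * E, ⟨?_, ?_⟩, ?_, W, hW1, hW2⟩
    · rw [starf, Es, Fs]
    · rw [prod, EE, FF]
    · unfold ProjLE
      rw [e1, prod, FP, Ep]
  have h1c : IsCentralProj (1 : A) := ⟨⟨star_one _, one_mul _⟩, fun a => by simp⟩
  have compl : ∀ x : A, IsCentralProj x → IsCentralProj (1 - x) := by
    rintro x ⟨⟨xs, xx⟩, xc⟩
    refine ⟨⟨by simp [xs], by simp [mul_sub, sub_mul, xx]⟩, fun a => ?_⟩
    simp [mul_sub, sub_mul, xc]
  have cmul : ∀ x t : A, IsCentralProj x → IsCentralProj t → IsCentralProj (x * t) := by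
    rintro x t ⟨⟨xs, xx⟩, xc⟩ ⟨⟨ts, tt⟩, tc⟩
    refine ⟨⟨by rw [star_mul, xs, ts, xc], ?_⟩, fun a => ?_⟩
    · rw [mul_assoc, ← mul_assoc t, ← xc t, mul_assoc x t t, tt, ← mul_assoc, xx]
    · rw [mul_assoc, tc, ← mul_assoc, xc, mul_assoc]
  have hzC : IsCentralProj z := ⟨⟨zs, zz⟩, hzc⟩
  have hyC : IsCentralProj y := ⟨⟨ys, yy⟩, yc⟩
  -- full support of anything of the form `z a + y b` with `{a, b} = {p, 1 - p}`
  have full : ∀ x : A, IsCentralProj x → x * e = 0 → x = 0 := by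
    intro x hx h0
    have t1 : x * z = 0 := by
      apply (hfull _ (cmul x z hx hzC)).1
      have : z * (x * e) = x * z * p := by
        rw [he, ← mul_assoc, hzc x, mul_add]
        have u1 : x * z * (z * p) = x * z * p := by rw [mul_assoc x, ← mul_assoc z, zz, ← mul_assoc]
        have u2 : x * z * (y * P') = 0 := by rw [mul_assoc x, ← mul_assoc z, zy]; simp
        rw [u1, u2, add_zero]
      rw [← this, h0, mul_zero]
    have t2 : x * y = 0 := by
      apply (hfull _ (cmul x y hx hyC)).2
      have : y * (x * e) = x * y * P' := by
        rw [he, ← mul_assoc, yc x, mul_add]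
        have u1 : x * y * (y * P') = x * y * P' := by
          rw [mul_assoc x, ← mul_assoc y, yy, ← mul_assoc]
        have u2 : x * y * (z * p) = 0 := by rw [mul_assoc x, ← mul_assoc y, yz]; simp
        rw [u1, u2, zero_add]
      rw [← this, h0, mul_zero]
    have : x = x * z + x * y := by rw [hy]; noncomm_ring
    rw [this, t1, t2, add_zero]
  have full' : ∀ x : A, IsCentralProj x → x * (1 - e) = 0 → x = 0 := by
    intro x hx h0
    apply full x hx
    have u0 : (1 - e) * W = W := by
      have a1 : P' * v = v := by
        have : P' * v = 2 * ((P' * P') * g * p) := by rw [hv]; noncomm_ring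
        rw [this, PP]
      have a2 : p * star v = star v := by
        have : p * star v = 2 * ((p * p) * g * P') := by rw [vs]; noncomm_ring
        rw [this, pp, vs]
      rw [e1, hW, prod, a1, a2]
    have u1 : x * W = 0 := by rw [← u0, ← mul_assoc, h0, zero_mul]
    rw [← hW1, ← mul_assoc, hx.2, mul_assoc, u1, mul_zero]
  refine ⟨e, heM, heP, ⟨h1c, mul_one _, ?_⟩, ⟨h1c, mul_one _, ?_⟩, hsubE⟩
  · intro x hx hex
    have := full (1 - x) (compl x hx) (by
      rw [(compl x hx).2, mul_sub, mul_one]; exact sub_eq_zero.2 hex.symm)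
    unfold ProjLE
    rw [one_mul]; exact (sub_eq_zero.1 this).symm
  · intro x hx hex
    have := full' (1 - x) (compl x hx) (by
      rw [(compl x hx).2, mul_sub _ 1 x, mul_one]; exact sub_eq_zero.2 hex.symm)
    unfold ProjLE
    rw [one_mul]; exact (sub_eq_zero.1 this).symm

/-- If an AW*-algebra `A` has no abelian central summands, then any maximal
abelian subalgebra `M` contains a projection `e` with `c(e) = 1 = c(1 - e)`
and `e ≼ 1 - e`. -/
theorem masa_projection_of_no_abelian_summand {A : Type u} [NormedRing A] [StarRing A]
    [CStarRing A] [NormedAlgebra ℂ A] [StarModule ℂ A] [CompleteSpace A]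
    (hAW : IsAWStarRing A)
    (hNoAbelian : ∀ z : A, IsCentralProj z → z ≠ 0 →
      ∃ a b : A, (z * a) * (z * b) ≠ (z * b) * (z * a))
    (M : StarSubalgebra ℂ A) (hM : IsMaximalAbelian M) :
    ∃ e : A, e ∈ M ∧ IsProjection e ∧ IsCentralCover e 1 ∧ IsCentralCover (1 - e) 1 ∧
      ProjSubEquiv e (1 - e) := by
  let : CStarAlgebra A := {}
  exact aux_main hAW hNoAbelian M hM
end

section
/- Let e be a nonzero projection in an AW*-algebra A. The following are equivalent: (a) there exist orthogonal projections e₁, e₂ with e₁ ∼ e₂ ∼ e and e = e₁ + e₂; (b) there exists an infinite orthogonal family {e_i} of projections with e_i ∼ e for all i and Σ e_i = e; (c) for every central projection z ∈ A, the projection ze is either zero or infinite. -/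
universe u

set_option linter.unusedSectionVars false

section Aux
variable {A : Type u} [NormedRing A] [StarRing A] [CStarRing A]

lemma orth_symm {e f : A} (he : IsProjection e) (hf : IsProjection f) (h : e * f = 0) : f * e = 0 := by
  have := congrArg star h
  rwa [star_mul, he.1, hf.1, star_zero] at this

lemma le_symm' {e f : A} (he : IsProjection e) (hf : IsProjection f) (h : e * f = e) : f * e = e := by
  have := congrArg star h
  rwa [star_mul, he.1, hf.1] at this

lemma proj_add {e f : A} (he : IsProjection e) (hf : IsProjection f) (h : e * f = 0) :
    IsProjection (e + f) := by
  refine ⟨by rw [star_add, he.1, hf.1], ?_⟩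
  simp only [mul_add, add_mul, he.2, hf.2, h, orth_symm he hf h]; abel

lemma proj_sub {e f : A} (he : IsProjection e) (hf : IsProjection f) (h : f * e = f) :
    IsProjection (e - f) := by
  refine ⟨by rw [star_sub, he.1, hf.1], ?_⟩
  simp only [mul_sub, sub_mul, he.2, hf.2, h, le_symm' hf he h]; abel

lemma proj_one : IsProjection (1 : A) := ⟨star_one _, mul_one _⟩

lemma proj_zero : IsProjection (0 : A) := ⟨star_zero _, mul_zero _⟩

lemma central_compl {z : A} (hz : IsCentralProj z) : IsCentralProj (1 - z) :=
  ⟨proj_sub proj_one hz.1 (mul_one _), fun a => by rw [sub_mul, mul_sub, hz.2, one_mul, mul_one]⟩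

lemma central_mul_proj {z e : A} (hz : IsCentralProj z) (he : IsProjection e) :
    IsProjection (z * e) := by
  refine ⟨by rw [star_mul, hz.1.1, he.1, hz.2], ?_⟩
  rw [mul_assoc, ← mul_assoc e, ← hz.2 e, mul_assoc z e e, he.2, ← mul_assoc, hz.1.2]

lemma central_mul {z y : A} (hz : IsCentralProj z) (hy : IsCentralProj y) :
    IsCentralProj (z * y) :=
  ⟨central_mul_proj hz hy.1, fun a => by rw [mul_assoc, hy.2, ← mul_assoc, hz.2, mul_assoc]⟩

lemma central_of {p : A} (hp : IsProjection p) (h : ∀ a, p * a * (1 - p) = 0) :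
    IsCentralProj p := by
  refine ⟨hp, fun a => ?_⟩
  have h1 : p * a = p * a * p := by
    have := h a; rw [mul_sub, mul_one, sub_eq_zero] at this; exact this
  have h2 : p * star a = p * star a * p := by
    have := h (star a); rw [mul_sub, mul_one, sub_eq_zero] at this; exact this
  have h3 := congrArg star h2
  simp only [star_mul, star_star, hp.1] at h3
  rw [h1, h3, mul_assoc]

lemma pi_mul {v : A} (h : IsProjection (star v * v)) : v * (star v * v) = v := by
  have : star (v * (star v * v) - v) * (v * (star v * v) - v) = 0 := by
    have h2 := h.2
    simp only [star_sub, star_mul, star_star, mul_sub, sub_mul, mul_assoc] at h2 ⊢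
    simp only [h2]; simp
  exact sub_eq_zero.1 ((CStarRing.star_mul_self_eq_zero_iff _).1 this)

lemma pi_proj {v : A} (h : IsProjection (star v * v)) : IsProjection (v * star v) := by
  refine ⟨by simp, ?_⟩
  have := pi_mul h
  calc v * star v * (v * star v) = (v * (star v * v)) * star v := by simp only [mul_assoc]
    _ = _ := by rw [this]

lemma pe_spec {e f : A} (he : IsProjection e) (h : ProjEquiv e f) :
    ∃ v : A, star v * v = e ∧ v * star v = f ∧ v * e = v ∧ f * v = v ∧ e * star v = star v ∧
      star v * f = star v := by
  obtain ⟨v, rfl, rfl⟩ := h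
  have h1 := pi_mul he
  have h2 := congrArg star h1
  simp only [star_mul, star_star] at h2
  exact ⟨v, rfl, rfl, h1, by rw [mul_assoc, h1], h2, by rw [← mul_assoc, h2]⟩

lemma pe_proj {e f : A} (he : IsProjection e) (h : ProjEquiv e f) : IsProjection f := by
  obtain ⟨v, rfl, rfl⟩ := h
  exact pi_proj he

lemma pe_symm {e f : A} (h : ProjEquiv e f) : ProjEquiv f e := by
  obtain ⟨v, h1, h2⟩ := h
  exact ⟨star v, by simpa using h2, by simpa using h1⟩

lemma pe_refl {e : A} (h : IsProjection e) : ProjEquiv e e :=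
  ⟨e, by rw [h.1, h.2], by rw [h.1, h.2]⟩

lemma pe_trans {e f g : A} (he : IsProjection e) (h : ProjEquiv e f) (h' : ProjEquiv f g) :
    ProjEquiv e g := by
  obtain ⟨v, a1, a2, a3, a4, a5, a6⟩ := pe_spec he h
  obtain ⟨w, b1, b2, b3, b4, b5, b6⟩ := pe_spec (pe_proj he h) h'
  refine ⟨w * v, ?_, ?_⟩
  · rw [star_mul, mul_assoc, ← mul_assoc (star w), b1, a4, a1]
  · rw [star_mul, mul_assoc, ← mul_assoc v, a2, b5, b2]

lemma pe_zero {e : A} (h : ProjEquiv e 0) : e = 0 := by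
  obtain ⟨v, h1, h2⟩ := h
  have : v = 0 := by
    have := (CStarRing.star_mul_self_eq_zero_iff (star v)).1 (by simpa using h2)
    simpa using this
  rw [← h1, this, mul_zero]

lemma pe_add {e₁ e₂ f₁ f₂ : A} (h1 : IsProjection e₁) (h2 : IsProjection e₂)
    (he : e₁ * e₂ = 0) (hf : f₁ * f₂ = 0) (h : ProjEquiv e₁ f₁) (h' : ProjEquiv e₂ f₂) :
    ProjEquiv (e₁ + e₂) (f₁ + f₂) := by
  obtain ⟨v, a1, a2, a3, a4, a5, a6⟩ := pe_spec h1 h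
  obtain ⟨w, b1, b2, b3, b4, b5, b6⟩ := pe_spec h2 h'
  have hf' := orth_symm (pe_proj h1 h) (pe_proj h2 h') hf
  have he' := orth_symm h1 h2 he
  have c1 : star v * w = 0 := by
    rw [← a6, ← b4, mul_assoc, ← mul_assoc f₁, hf, zero_mul, mul_zero]
  have c2 : star w * v = 0 := by
    rw [← b6, ← a4, mul_assoc, ← mul_assoc f₂, hf', zero_mul, mul_zero]
  have c3 : v * star w = 0 := by
    rw [← a3, ← b5, mul_assoc, ← mul_assoc e₁, he, zero_mul, mul_zero]
  have c4 : w * star v = 0 := by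
    rw [← b3, ← a5, mul_assoc, ← mul_assoc e₂, he', zero_mul, mul_zero]
  refine ⟨v + w, ?_, ?_⟩
  · simp only [star_add, mul_add, add_mul, a1, b1, c1, c2]; abel
  · simp only [star_add, mul_add, add_mul, a2, b2, c3, c4]; abel

lemma pe_central {z e f : A} (hz : IsCentralProj z) (h : ProjEquiv e f) :
    ProjEquiv (z * e) (z * f) := by
  obtain ⟨v, h1, h2⟩ := h
  refine ⟨z * v, ?_, ?_⟩
  · rw [star_mul, hz.1.1, mul_assoc, ← mul_assoc z, hz.1.2, ← mul_assoc, ← hz.2, mul_assoc, h1]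
  · rw [star_mul, hz.1.1, mul_assoc, ← hz.2, ← mul_assoc v, ← hz.2, ← mul_assoc, ← mul_assoc, hz.1.2, mul_assoc, h2]

/-- restriction of an equivalence to a subprojection -/
lemma pe_sub {q e f : A} (hq : IsProjection q) (he : IsProjection e) (hqe : q * e = q)
    (h : ProjEquiv e f) : ProjSubEquiv q f := by
  obtain ⟨v, a1, a2, a3, a4, a5, a6⟩ := pe_spec he h
  have hs : star (v * q) * (v * q) = q := by
    rw [star_mul, hq.1, mul_assoc, ← mul_assoc (star v), a1, le_symm' hq he hqe, hq.2]
  refine ⟨v * q * star (v * q), pi_proj (by rw [hs]; exact hq), ?_, v * q, hs, rfl⟩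
  unfold ProjLE
  rw [star_mul, mul_assoc, mul_assoc, mul_assoc, mul_assoc, a6]

lemma pse_trans {e f g : A} (he : IsProjection e) (hf : IsProjection f)
    (h : ProjSubEquiv e f) (h' : ProjSubEquiv f g) : ProjSubEquiv e g := by
  obtain ⟨x, hx, hxf, hex⟩ := h
  obtain ⟨y, hy, hyg, hfy⟩ := h'
  obtain ⟨x', hx', hxy, hxx⟩ := pe_sub hx hf hxf hfy
  refine ⟨x', hx', ?_, pe_trans he hex hxx⟩
  unfold ProjLE at *
  rw [← hxy, mul_assoc, hyg]

/-! suprema through annihilators -/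

def IsSp {ι : Type*} (p : ι → A) (s : A) : Prop :=
  IsProjection s ∧ ∀ y, (∀ i, p i * y = 0) ↔ s * y = 0

lemma exists_sp (hAW : IsAWStarRing A) {ι : Type*} (p : ι → A) : ∃ s, IsSp p s := by
  obtain ⟨q, hq, h⟩ := hAW (Set.range p)
  refine ⟨1 - q, proj_sub proj_one hq (mul_one _), fun y => ?_⟩
  have h1 : (∀ i, p i * y = 0) ↔ ∃ b, y = q * b := by
    have := Set.ext_iff.1 h y
    simpa using this
  rw [h1]
  constructor
  · rintro ⟨b, rfl⟩
    rw [sub_mul, one_mul, ← mul_assoc, hq.2, sub_self]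
  · intro h2
    rw [sub_mul, one_mul, sub_eq_zero] at h2
    exact ⟨y, h2⟩

variable {ι κ : Type*}

lemma sp_le {p : ι → A} {s : A} (h : IsSp p s) (i : ι) : p i * s = p i := by
  have := (h.2 (1 - s)).2 (by rw [mul_sub, mul_one, h.1.2, sub_self]) i
  rw [mul_sub, mul_one, sub_eq_zero] at this
  exact this.symm

lemma sp_le_of {p : ι → A} {s t : A} (h : IsSp p s) (ht : ∀ i, p i * t = p i) : s * t = s := by
  have := (h.2 (1 - t)).1 (fun i => by rw [mul_sub, mul_one, ht, sub_self])
  rw [mul_sub, mul_one, sub_eq_zero] at this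
  exact this.symm

lemma sp_right {p : ι → A} {s y : A} (h : IsSp p s) (hp : ∀ i, star (p i) = p i)
    (hy : ∀ i, y * p i = 0) : y * s = 0 := by
  have := (h.2 (star y)).1 (fun i => by
    have := congrArg star (hy i)
    rwa [star_mul, hp, star_zero] at this)
  have := congrArg star this
  rwa [star_mul, star_star, star_zero, h.1.1] at this

lemma sp_unique {p : ι → A} {s t : A} (h : IsSp p s) (h' : IsSp p t) : s = t := by
  have h1 := sp_le_of h (sp_le h')
  have h2 := sp_le_of h' (sp_le h)
  rw [← h1, le_symm' h'.1 h.1 h2]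

lemma sp_orth {p : ι → A} {q : κ → A} {P Q : A} (h : IsSp p P) (h' : IsSp q Q)
    (hq : ∀ i, star (q i) = q i) (ho : ∀ i j, p i * q j = 0) : P * Q = 0 :=
  (h.2 Q).1 fun i => sp_right h' hq (ho i)

lemma add_ann {p q y : A} (hp : IsProjection p) (hq : IsProjection q) (h : p * q = 0) :
    (p + q) * y = 0 ↔ p * y = 0 ∧ q * y = 0 := by
  constructor
  · intro h1
    have a : p * ((p + q) * y) = p * y := by
      rw [← mul_assoc, mul_add, hp.2, h, add_zero]
    have b : q * ((p + q) * y) = q * y := by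
      rw [← mul_assoc, mul_add, hq.2, orth_symm hp hq h, zero_add]
    rw [h1, mul_zero] at a b
    exact ⟨a.symm, b.symm⟩
  · rintro ⟨a, b⟩
    rw [add_mul, a, b, add_zero]

lemma sp_add {p q : ι → A} {P Q : A} (h : IsSp p P) (h' : IsSp q Q)
    (hp : ∀ i, IsProjection (p i)) (hq : ∀ i, IsProjection (q i)) (ho : P * Q = 0)
    (ho' : ∀ i, p i * q i = 0) : IsSp (fun i => p i + q i) (P + Q) := by
  refine ⟨proj_add h.1 h'.1 ho, fun y => ?_⟩
  rw [add_ann h.1 h'.1 ho, ← h.2, ← h'.2, ← forall_and]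
  exact forall_congr' fun i => add_ann (hp i) (hq i) (ho' i)

lemma sp_sum {p : ι → A} {q : κ → A} {P Q : A} (h : IsSp p P) (h' : IsSp q Q)
    (ho : P * Q = 0) : IsSp (Sum.elim p q) (P + Q) := by
  refine ⟨proj_add h.1 h'.1 ho, fun y => ?_⟩
  rw [add_ann h.1 h'.1 ho, ← h.2, ← h'.2]
  simp

lemma sp_option {p : ι → A} {P r : A} (h : IsSp p P) (hr : IsProjection r)
    (ho : P * r = 0) : IsSp (fun o : Option ι => o.elim r p) (P + r) := by
  refine ⟨proj_add h.1 hr ho, fun y => ?_⟩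
  rw [add_ann h.1 hr ho, ← h.2, Option.forall]
  simp [and_comm]

lemma sp_central {p : ι → A} {P z : A} (h : IsSp p P) (hz : IsCentralProj z) :
    IsSp (fun i => z * p i) (z * P) := by
  refine ⟨central_mul_proj hz h.1, fun y => ?_⟩
  have : ∀ x : A, z * x * y = x * (z * y) := fun x => by rw [hz.2, mul_assoc]
  simp only [this]
  exact h.2 _

lemma sp_equiv {p : ι → A} {P : A} (h : IsSp p P) (σ : κ ≃ ι) : IsSp (fun i => p (σ i)) P := by
  refine ⟨h.1, fun y => ?_⟩
  rw [← h.2]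
  exact ⟨fun h i => by simpa using h (σ.symm i), fun h i => h _⟩

end Aux

section Aux2
variable {A : Type u} [NormedRing A] [StarRing A] [CStarRing A]

lemma orth_add (hAW : IsAWStarRing A) {ι : Type*} {e f : ι → A} {E F : A}
    (he : ∀ i, IsProjection (e i))
    (hE : IsSp e E) (hF : IsSp f F) (heo : PairwiseOrthogonal e) (hfo : PairwiseOrthogonal f)
    (hEF : E * F = 0) (h : ∀ i, ProjEquiv (e i) (f i)) : ProjEquiv E F := by
  choose v a1 a2 a3 a4 a5 a6 using fun i => pe_spec (he i) (h i)
  have hf : ∀ i, IsProjection (f i) := fun i => pe_proj (he i) (h i)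
  have hFE := orth_symm hE.1 hF.1 hEF
  have eE := sp_le hE
  have fF := sp_le hF
  have Ee := fun i => le_symm' (he i) hE.1 (eE i)
  have Ff := fun i => le_symm' (hf i) hF.1 (fF i)
  have ef : ∀ i j, e i * f j = 0 := fun i j => by
    rw [← eE, ← Ff, mul_assoc, ← mul_assoc E, hEF, zero_mul, mul_zero]
  have fe : ∀ i j, f i * e j = 0 := fun i j => orth_symm (he j) (hf i) (ef j i)
  have Fe : ∀ i, F * e i = 0 := fun i => by rw [← Ee, ← mul_assoc, hFE, zero_mul]
  have Ef : ∀ i, E * f i = 0 := fun i => by rw [← Ff, ← mul_assoc, hEF, zero_mul]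
  have Fv : ∀ i, F * v i = v i := fun i => by rw [← a4, ← mul_assoc, Ff]
  have Ev : ∀ i, E * star (v i) = star (v i) := fun i => by rw [← a5, ← mul_assoc, Ee]
  have vv : ∀ i j, v i * v j = 0 := fun i j => by
    rw [← a3 i, ← a4 j, mul_assoc, ← mul_assoc (e i), ef, zero_mul, mul_zero]
  have ss : ∀ i j, star (v i) * star (v j) = 0 := fun i j => by
    rw [← star_mul, vv, star_zero]
  have ev : ∀ i j, e i * v j = 0 := fun i j => by rw [← a4 j, ← mul_assoc, ef, zero_mul]
  have vf : ∀ i j, v i * f j = 0 := fun i j => by rw [← a3 i, mul_assoc, ef, mul_zero]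
  have fs : ∀ i j, f i * star (v j) = 0 := fun i j => by rw [← a5 j, ← mul_assoc, fe, zero_mul]
  have se : ∀ i j, star (v i) * e j = 0 := fun i j => by rw [← a6 i, mul_assoc, fe, mul_zero]
  have sv' : ∀ i j, i ≠ j → star (v i) * v j = 0 := fun i j hij => by
    rw [← a6 i, ← a4 j, mul_assoc, ← mul_assoc (f i), hfo i j hij, zero_mul, mul_zero]
  have vs' : ∀ i j, i ≠ j → v i * star (v j) = 0 := fun i j hij => by
    rw [← a3 i, ← a5 j, mul_assoc, ← mul_assoc (e i), heo i j hij, zero_mul, mul_zero]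
  have es' : ∀ i j, i ≠ j → e i * star (v j) = 0 := fun i j hij => by
    rw [← a5 j, ← mul_assoc, heo i j hij, zero_mul]
  have ve' : ∀ i j, i ≠ j → v i * e j = 0 := fun i j hij => by
    rw [← a3 i, mul_assoc, heo i j hij, mul_zero]
  have fv' : ∀ i j, i ≠ j → f i * v j = 0 := fun i j hij => by
    rw [← a4 j, ← mul_assoc, hfo i j hij, zero_mul]
  have sf' : ∀ i j, i ≠ j → star (v i) * f j = 0 := fun i j hij => by
    rw [← a6 i, mul_assoc, hfo i j hij, mul_zero]
  obtain ⟨G, hG⟩ := exists_sp hAW (fun i => e i + v i + star (v i) + f i)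
  have gs : ∀ i, star (e i + v i + star (v i) + f i) = e i + v i + star (v i) + f i := fun i => by
    simp only [star_add, star_star, (he i).1, (hf i).1]; abel
  have Gg : ∀ i, G * (e i + v i + star (v i) + f i) = e i + v i + star (v i) + f i := fun i => by
    have := congrArg star (sp_le hG i)
    simp only [star_mul, hG.1.1, gs] at this
    exact this
  have Gh : ∀ j, G * (e j - v j - star (v j) + f j) = 0 := fun j => by
    refine (hG.2 _).1 fun i => ?_
    by_cases hij : i = j
    · subst hij
      simp only [mul_add, mul_sub, add_mul, (he i).2, (hf i).2, a1, a2, a3, a4, a5, a6, vv, ss, ev, ef, fe, vf, fs, se]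
      abel
    · simp only [mul_add, mul_sub, add_mul, vv, ss, ev, ef, fe, vf, fs, se, heo i j hij, hfo i j hij,
        sv' i j hij, vs' i j hij, es' i j hij, ve' i j hij, fv' i j hij, sf' i j hij]
      simp
  have G2 : ∀ i, G * (e i + f i) + G * (e i + f i) = e i + v i + star (v i) + f i := fun i => by
    rw [← Gg i, ← add_zero (G * (e i + v i + star (v i) + f i)), ← Gh i, ← mul_add, ← mul_add]
    congr 1; abel
  have Ge : ∀ i, G * e i + G * e i = e i + v i := fun i => by
    have := congrArg (· * e i) (G2 i)
    simp only [add_mul, mul_add, mul_assoc, (he i).2, fe, se, a3, mul_zero, add_zero] at this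
    exact this
  have Gf : ∀ i, G * f i + G * f i = star (v i) + f i := fun i => by
    have := congrArg (· * f i) (G2 i)
    simp only [add_mul, mul_add, mul_assoc, (hf i).2, ef, vf, a6, mul_zero, zero_add] at this
    exact this
  set W := F * (G + G) * E with hW
  have sW : star W = E * (G + G) * F := by
    simp only [hW, star_mul, star_add, hE.1.1, hF.1.1, hG.1.1, mul_assoc]
  have We : ∀ i, W * e i = v i := fun i => by
    rw [hW, mul_assoc, Ee, mul_assoc, add_mul, Ge, mul_add, Fe, Fv, zero_add]
  have Wf : ∀ i, star W * f i = star (v i) := fun i => by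
    rw [sW, mul_assoc, Ff, mul_assoc, add_mul, Gf, mul_add, Ef, Ev, add_zero]
  refine ⟨W, ?_, ?_⟩
  · have : (star W * W - E) * E = 0 := by
      refine sp_right hE (fun i => (he i).1) fun i => ?_
      rw [sub_mul, mul_assoc, We, Ee, ← a4, ← mul_assoc, Wf, a1, sub_self]
    rw [sub_mul, mul_assoc, hE.1.2, sub_eq_zero] at this
    rw [← this, hW, mul_assoc _ E E, hE.1.2]
  · have : (W * star W - F) * F = 0 := by
      refine sp_right hF (fun i => (hf i).1) fun i => ?_
      rw [sub_mul, mul_assoc, Wf, Ff, ← a5, ← mul_assoc, We, a2, sub_self]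
    rw [sub_mul, mul_assoc, hF.1.2, sub_eq_zero] at this
    rw [← this, sW, mul_assoc _ F F, hF.1.2]

def dn (v d : A) : ℕ → A
  | 0 => d
  | n + 1 => v * dn v d n * star v

lemma dn_spec {v d e f : A} (he : IsProjection e) (a1 : star v * v = e) (a2 : v * star v = f)
    (hfe : f * e = f)
    (hd : IsProjection d) (hde : d * e = d) (hdf : d * f = 0) :
    (∀ n, IsProjection (dn v d n) ∧ dn v d n * e = dn v d n ∧ ProjEquiv d (dn v d n)) ∧
    PairwiseOrthogonal (dn v d) := by
  have hf : IsProjection f := by rw [← a2]; exact pi_proj (by rw [a1]; exact he)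
  have ve : v * e = v := by rw [← a1]; exact pi_mul (by rw [a1]; exact he)
  have es : e * star v = star v := by
    have := congrArg star ve; rwa [star_mul, he.1] at this
  have fv : f * v = v := by rw [← a2, mul_assoc, a1, ve]
  have sf : star v * f = star v := by
    have := congrArg star fv; rwa [star_mul, hf.1] at this
  have key : ∀ n, IsProjection (dn v d n) ∧ dn v d n * e = dn v d n ∧ ProjEquiv d (dn v d n) := by
    intro n
    induction n with
    | zero => exact ⟨hd, hde, pe_refl hd⟩
    | succ n ih =>
      obtain ⟨h1, h2, h3⟩ := ih
      have h4 := le_symm' h1 he h2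
      have h5 : ProjEquiv (dn v d n) (dn v d (n + 1)) := by
        refine ⟨v * dn v d n, ?_, ?_⟩
        · rw [star_mul, h1.1, mul_assoc, ← mul_assoc (star v), a1, h4, h1.2]
        · rw [star_mul, h1.1, mul_assoc, ← mul_assoc (dn v d n), h1.2, ← mul_assoc]; rfl
      refine ⟨pe_proj h1 h5, ?_, pe_trans hd h3 h5⟩
      change v * dn v d n * star v * e = v * dn v d n * star v
      rw [mul_assoc, ← sf, mul_assoc (star v), hfe]
  refine ⟨key, ?_⟩
  have h0 : ∀ m, dn v d 0 * dn v d (m + 1) = 0 := fun m => by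
    change d * (v * dn v d m * star v) = 0
    rw [← fv]; simp only [← mul_assoc]; rw [hdf]; simp
  intro n
  induction n with
  | zero =>
    intro m hm
    cases m with
    | zero => exact absurd rfl hm
    | succ m => exact h0 m
  | succ n ih =>
    intro m hm
    cases m with
    | zero => exact orth_symm hd (key _).1 (h0 n)
    | succ m =>
      have := ih m (by omega)
      change (v * dn v d n * star v) * (v * dn v d m * star v) = 0
      calc _ = v * (dn v d n * (star v * v) * dn v d m) * star v := by simp only [mul_assoc]
        _ = 0 := by rw [a1, (key n).2.1, this]; simp

lemma schroeder (hAW : IsAWStarRing A) {q f : A} (hq : IsProjection q) (hf : IsProjection f)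
    (hfq : f * q = f) (h : ProjSubEquiv q f) : ProjEquiv q f := by
  obtain ⟨f', hf', hff, hqf⟩ := h
  obtain ⟨v, a1, a2, a3, a4, a5, a6⟩ := pe_spec hq hqf
  unfold ProjLE at hff
  have hqf' := le_symm' hf hq hfq
  have hfq' : f' * q = f' := by rw [← hff, mul_assoc, hfq]
  have hff' := le_symm' hf' hf hff
  have hd := proj_sub hq hf hfq
  set d := q - f with hdd
  have hdq : d * q = d := by rw [hdd, sub_mul, hq.2, hfq]
  have hdf : d * f' = 0 := by rw [hdd, sub_mul, hff', le_symm' hf' hq hfq', sub_self]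
  obtain ⟨h1, h2⟩ := dn_spec hq a1 a2 hfq' hd hdq hdf
  obtain ⟨D, hD⟩ := exists_sp hAW (dn v d)
  have Dq : D * q = D := sp_le_of hD fun n => (h1 n).2.1
  have qD := le_symm' hD.1 hq Dq
  have hvD : ProjEquiv D (v * D * star v) := by
    refine ⟨v * D, ?_, ?_⟩
    · rw [star_mul, hD.1.1, mul_assoc, ← mul_assoc (star v), a1, qD, hD.1.2]
    · rw [star_mul, hD.1.1, mul_assoc, ← mul_assoc D, hD.1.2, ← mul_assoc]
  have hvp := pe_proj hD.1 hvD
  have ho : d * (v * D * star v) = 0 := by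
    rw [← a4]; simp only [← mul_assoc]; rw [hdf]; simp
  have hDeq : D = d + v * D * star v := by
    refine sp_unique hD ⟨proj_add hd hvp ho, fun y => ?_⟩
    rw [add_ann hd hvp ho]
    have e1 : v * D * star v * y = 0 ↔ D * (star v * y) = 0 := by
      constructor
      · intro h
        have := congrArg (star v * ·) h
        simp only [← mul_assoc, a1, qD, mul_zero] at this
        rw [← mul_assoc]; exact this
      · intro h; simp only [mul_assoc, h, mul_zero]
    have e2 : ∀ n, dn v d (n + 1) * y = 0 ↔ dn v d n * (star v * y) = 0 := fun n => by
      change v * dn v d n * star v * y = 0 ↔ _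
      constructor
      · intro h
        have := congrArg (star v * ·) h
        simp only [← mul_assoc, a1, le_symm' (h1 n).1 hq (h1 n).2.1, mul_zero] at this
        rw [← mul_assoc]; exact this
      · intro h; simp only [mul_assoc, h, mul_zero]
    rw [e1, ← hD.2]
    simp only [← e2]
    constructor
    · intro h; exact ⟨h 0, fun n => h _⟩
    · rintro ⟨h, h'⟩ n
      cases n with
      | zero => exact h
      | succ n => exact h' n
  have hqD := proj_sub hq hD.1 Dq
  have e1 : q = (q - D) + D := by abel
  have e2 : f = (q - D) + v * D * star v := by
    have : v * D * star v = D - d := by rw [eq_sub_iff_add_eq']; exact hDeq.symm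
    rw [this, hdd]; abel
  rw [e1, e2]
  refine pe_add hqD hD.1 ?_ ?_ (pe_refl hqD) hvD
  · rw [sub_mul, qD, hD.1.2, sub_self]
  · have : D * (v * D * star v) = v * D * star v := by
      nth_rw 1 [hDeq]; rw [add_mul, ho, hvp.2, zero_add]
    rw [sub_mul, this, sub_eq_zero, ← this, ← mul_assoc, qD]

lemma zorn_fam {α : Type*} (r : α → α → Prop) (Q : α → Prop) (S0 : Set α)
    (hQ : ∀ x ∈ S0, Q x) (hr : ∀ x ∈ S0, ∀ y ∈ S0, x ≠ y → r x y) :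
    ∃ T : Set α, S0 ⊆ T ∧ (∀ x ∈ T, Q x) ∧ (∀ x ∈ T, ∀ y ∈ T, x ≠ y → r x y) ∧
      ∀ x, Q x → (∀ y ∈ T, r x y ∧ r y x) → x ∈ T := by
  obtain ⟨T, hT, hm⟩ := zorn_subset_nonempty
    {T : Set α | (∀ x ∈ T, Q x) ∧ (∀ x ∈ T, ∀ y ∈ T, x ≠ y → r x y)} (by
      intro c hc hch _
      refine ⟨⋃₀ c, ⟨?_, ?_⟩, fun s hs => Set.subset_sUnion_of_mem hs⟩
      · rintro x ⟨s, hs, hx⟩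
        exact (hc hs).1 x hx
      · rintro x ⟨s, hs, hx⟩ y ⟨t, ht, hy⟩ hxy
        rcases hch.total hs ht with h | h
        · exact (hc ht).2 x (h hx) y hy hxy
        · exact (hc hs).2 x hx y (h hy) hxy) S0 ⟨hQ, hr⟩
  refine ⟨T, hT, hm.prop.1, hm.prop.2, fun x hx hxT => ?_⟩
  have : insert x T ⊆ T := by
    refine hm.le_of_ge ⟨?_, ?_⟩ (Set.subset_insert _ _)
    · rintro y (rfl | hy)
      · exact hx
      · exact hm.prop.1 y hy
    · rintro y (rfl | hy) z (rfl | hz) hyz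
      · exact absurd rfl hyz
      · exact (hxT z hz).1
      · exact (hxT y hy).2
      · exact hm.prop.2 y hy z hz hyz
  exact this (Set.mem_insert _ _)

end Aux2

section Aux3
variable {A : Type u} [NormedRing A] [StarRing A] [CStarRing A] [NormedAlgebra ℂ A]
  [StarModule ℂ A] [CompleteSpace A]

lemma ep (hAW : IsAWStarRing A) {a p q : A} (ha : a ≠ 0) (hap : a * p = a) (hqa : q * a = a) :
    ∃ v : A, v ≠ 0 ∧ IsProjection (star v * v) ∧ v * p = v ∧ q * v = v := by
  let _ : CStarAlgebra A := { }
  set b := star a * a with hb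
  have hbs : IsSelfAdjoint b := IsSelfAdjoint.star_mul_self a
  have hb0 : b ≠ 0 := fun h => ha ((CStarRing.star_mul_self_eq_zero_iff a).1 h)
  have hnn : ∀ x ∈ spectrum ℝ b, 0 ≤ x := fun x hx => spectrum_star_mul_self_nonneg x hx
  obtain ⟨x, hx, hx0⟩ : ∃ x ∈ spectrum ℝ b, x ≠ 0 := by
    by_contra! hcon
    apply hb0
    rw [← cfc_id' ℝ b]
    rw [cfc_congr (g := fun _ => 0) (fun x hx => hcon x hx)]
    exact cfc_const_zero ℝ b
  have hxp : 0 < x := lt_of_le_of_ne (hnn x hx) (Ne.symm hx0)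
  set ε := x / 2 with hε
  have hεp : 0 < ε := by positivity
  set k' : ℝ → ℝ := fun t => max (t - ε) 0 with hk'
  have ck' : Continuous k' := by fun_prop
  set k : ℝ → ℝ := fun t => k' t * t with hk
  have ck : Continuous k := by fun_prop
  set φ : ℝ → ℝ := fun t => (Real.sqrt (max t ε))⁻¹ with hφ
  have cφ : Continuous φ := by
    refine Continuous.inv₀ (by fun_prop) fun t => ?_
    exact (Real.sqrt_pos.2 (lt_of_lt_of_le hεp (le_max_right _ _))).ne'
  set K := cfc k b with hK
  set F := cfc φ b with hF
  have Ks : star K = K := (cfc_predicate k b : IsSelfAdjoint _)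
  have Fs : star F = F := (cfc_predicate φ b : IsSelfAdjoint _)
  have hK1 : K = cfc k' b * b := by
    rw [hK, hk, cfc_mul k' (fun t => t) b ck'.continuousOn continuousOn_id, cfc_id' ℝ b]
  have hK0 : K ≠ 0 := by
    intro h
    have h1 := cfc_map_spectrum (R := ℝ) k b hbs ck.continuousOn
    have h2 : k x ∈ spectrum ℝ K := by rw [hK, h1]; exact ⟨x, hx, rfl⟩
    have : Nontrivial A := ⟨a, 0, ha⟩
    rw [h, spectrum.zero_eq, Set.mem_singleton_iff] at h2
    have : k x = x / 2 * x := by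
      simp only [hk, hk', hε]; rw [max_eq_left (by linarith)]; ring
    rw [this] at h2
    have : 0 < x / 2 * x := by positivity
    linarith
  have hFbF : F * b * F = cfc (fun t => φ t * t * φ t) b := by
    rw [cfc_mul (fun t => φ t * t) φ b (by fun_prop) (by fun_prop),
      cfc_mul φ (fun t => t) b (by fun_prop) (by fun_prop), cfc_id' ℝ b]
  have hKF : K * (F * b * F) = K := by
    rw [hFbF, hK, ← cfc_mul k _ b (by fun_prop) (by fun_prop)]
    refine cfc_congr fun t ht => ?_
    by_cases h : ε ≤ t
    · have h3 : φ t * t * φ t = 1 := by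
        simp only [hφ, max_eq_left h]
        have ht0 : 0 < t := lt_of_lt_of_le hεp h
        have h4 := Real.mul_self_sqrt ht0.le
        have h5 := (Real.sqrt_pos.2 ht0).ne'
        field_simp
        rw [sq, h4]
      simp [h3]
    · have : k t = 0 := by
        simp only [hk, hk']; rw [max_eq_right (by linarith), zero_mul]
      simp [this]
  obtain ⟨g, hg⟩ := exists_sp hAW (fun _ : Unit => K)
  have hgann : ∀ y, K * y = 0 → g * y = 0 := fun y hy => (hg.2 y).1 fun _ => hy
  have hg0 : g ≠ 0 := fun h => by
    have := sp_le hg ()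
    rw [h, mul_zero] at this
    exact hK0 this.symm
  have hgF : g * (F * b * F) = g := by
    have := hgann (F * b * F - 1) (by rw [mul_sub, hKF, mul_one, sub_self])
    rwa [mul_sub, mul_one, sub_eq_zero] at this
  have hgp : g * p = g := by
    have := hgann (p - 1) (by
      rw [hK1, hb, mul_sub, mul_one, mul_assoc, mul_assoc, hap, sub_self])
    rwa [mul_sub, mul_one, sub_eq_zero] at this
  have hvv : star (a * F * g) * (a * F * g) = g := by
    calc star (a * F * g) * (a * F * g) = g * (F * b * F) * g := by
          simp only [star_mul, Fs, hg.1.1, hb, mul_assoc]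
      _ = g := by rw [hgF, hg.1.2]
  refine ⟨a * F * g, ?_, by rw [hvv]; exact hg.1, by rw [mul_assoc, hgp], ?_⟩
  · intro h; rw [h, mul_zero] at hvv; exact hg0 hvv.symm
  · rw [← mul_assoc, ← mul_assoc, hqa]

lemma gc (hAW : IsAWStarRing A) {r g : A} (hr : IsProjection r) (hg : IsProjection g)
    (hrg : r * g = 0) : ∃ h : A, IsCentralProj h ∧ ProjSubEquiv (h * r) (h * g) ∧
      ProjSubEquiv ((1 - h) * g) ((1 - h) * r) := by
  obtain ⟨T, -, hT, hTo, hTm⟩ := zorn_fam (fun v w : A => star v * w = 0 ∧ v * star w = 0)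
    (fun v => v ≠ 0 ∧ IsProjection (star v * v) ∧ v * r = v ∧ g * v = v) ∅ (by simp) (by simp)
  obtain ⟨E, hE⟩ := exists_sp hAW (fun v : T => star (v : A) * v)
  obtain ⟨F, hF⟩ := exists_sp hAW (fun v : T => (v : A) * star (v : A))
  have Er : E * r = E := sp_le_of hE fun v => by rw [mul_assoc, (hT v v.2).2.2.1]
  have Fg : F * g = F := sp_le_of hF fun v => by
    have := congrArg star (hT v v.2).2.2.2
    rw [star_mul, hg.1] at this
    rw [mul_assoc, this]
  have rE := le_symm' hE.1 hr Er
  have gF := le_symm' hF.1 hg Fg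
  have hEF : E * F = 0 := by
    rw [← Er, ← gF, mul_assoc, ← mul_assoc r, hrg, zero_mul, mul_zero]
  have hpe : ProjEquiv E F := by
    refine orth_add hAW (fun v : T => (hT v v.2).2.1) hE hF ?_ ?_ hEF fun v : T => ⟨(v : A), rfl, rfl⟩
    · intro v w hvw
      have := (hTo v v.2 w w.2 (fun h => hvw (Subtype.ext h))).2
      simp only [mul_assoc]; rw [← mul_assoc (v : A), this]; simp
    · intro v w hvw
      have := (hTo v v.2 w w.2 (fun h => hvw (Subtype.ext h))).1
      simp only [mul_assoc]; rw [← mul_assoc (star (v : A)), this]; simp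
  have hrE := proj_sub hr hE.1 Er
  have hgF := proj_sub hg hF.1 Fg
  have gFw : ∀ w ∈ T, (g - F) * w = 0 := fun w hw => by
    have h1 := le_symm' (pi_proj (hT w hw).2.1) hF.1 (sp_le hF ⟨w, hw⟩)
    have h2 : F * w = w := by
      have h3 := pi_mul (hT w hw).2.1
      rw [← h3, ← mul_assoc w, ← mul_assoc F, h1]
    rw [sub_mul, h2, (hT w hw).2.2.2, sub_self]
  have rEw : ∀ w ∈ T, w * (r - E) = 0 := fun w hw => by
    have h1 := sp_le hE ⟨w, hw⟩
    have h2 : w * E = w := by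
      have h3 := pi_mul (hT w hw).2.1
      rw [← h3, mul_assoc w, h1]
    rw [mul_sub, h2, (hT w hw).2.2.1, sub_self]
  have hann : ∀ x, (r - E) * x * (g - F) = 0 := by
    intro x
    by_contra hx
    have ha : (g - F) * star x * (r - E) ≠ 0 := by
      intro h
      apply hx
      have := congrArg star h
      simpa only [star_mul, star_star, hrE.1, hgF.1, star_zero, mul_assoc] using this
    obtain ⟨v, hv0, hv, hvr, hvg⟩ := ep hAW ha (p := r - E) (q := g - F)
      (by rw [mul_assoc, hrE.2]) (by rw [mul_assoc, ← mul_assoc (g - F), hgF.2])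
    have hvT : v ∈ T := by
      refine hTm v ⟨hv0, hv, ?_, ?_⟩ fun w hw => ?_
      · rw [← hvr, mul_assoc, sub_mul, hr.2, Er]
      · rw [← hvg, ← mul_assoc, mul_sub, hg.2, gF]
      · have h1 : star v * w = 0 := by
          rw [← hvg, star_mul, hgF.1, mul_assoc, gFw w hw, mul_zero]
        have h2 : w * star v = 0 := by
          rw [← hvr, star_mul, hrE.1, ← mul_assoc, rEw w hw, zero_mul]
        have h3 := congrArg star h1
        have h4 := congrArg star h2
        simp only [star_mul, star_star, star_zero] at h3 h4
        exact ⟨⟨h1, h4⟩, h3, h2⟩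
    exact hv0 (by rw [← hvg, gFw v hvT])
  obtain ⟨k, hk⟩ := exists_sp hAW (fun x : A => (r - E) * x)
  have hkc : IsCentralProj k := by
    refine central_of hk.1 fun a => ?_
    rw [mul_assoc]
    refine (hk.2 _).1 fun x => ?_
    have := (hk.2 (1 - k)).2 (by rw [mul_sub, mul_one, hk.1.2, sub_self]) (x * a)
    simpa only [mul_assoc] using this
  have hhc := central_compl hkc
  have h1 : (1 - k) * r = (1 - k) * E := by
    have := (hk.2 (1 - k)).2 (by rw [mul_sub, mul_one, hk.1.2, sub_self]) 1
    simp only [mul_one] at this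
    rw [← hhc.2, mul_sub, sub_eq_zero] at this
    exact this
  have h2 : k * g = k * F := by
    have := (hk.2 (g - F)).1 fun x => hann x
    rwa [mul_sub, sub_eq_zero] at this
  refine ⟨1 - k, hhc, ?_, ?_⟩
  · rw [h1]
    refine ⟨(1 - k) * F, central_mul_proj hhc hF.1, ?_, pe_central hhc hpe⟩
    unfold ProjLE
    rw [hhc.2 g, ← mul_assoc, mul_assoc _ F g, Fg, mul_assoc, ← hhc.2 F, ← mul_assoc, hhc.1.2]
  · rw [sub_sub_cancel, h2]
    refine ⟨k * E, central_mul_proj hkc hE.1, ?_, pe_central hkc (pe_symm hpe)⟩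
    unfold ProjLE
    rw [hkc.2 r, ← mul_assoc, mul_assoc _ E r, Er, mul_assoc, ← hkc.2 E, ← mul_assoc, hkc.1.2]

end Aux3

section Aux4
variable {A : Type u} [NormedRing A] [StarRing A] [CStarRing A]

def PP (x : A) : Prop := ∃ a b c : A, IsProjection a ∧ IsProjection b ∧ IsProjection c ∧
  a * b = 0 ∧ a * c = 0 ∧ b * c = 0 ∧ a + b + c = x ∧ ProjEquiv a b ∧ ProjEquiv b c ∧
  ProjEquiv a (b + c)

lemma block (hAW : IsAWStarRing A) {κ : Type u} [Infinite κ] {G : κ ⊕ (κ ⊕ κ) → A} {S R : A}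
    (hG : ∀ i, IsProjection (G i)) (ho : PairwiseOrthogonal G) (hS : IsSp G S)
    (he : ∀ i j, ProjEquiv (G i) (G j)) (hR : IsProjection R) (hSR : S * R = 0)
    (hsub : ∀ i, ProjSubEquiv R (G i)) : PP (S + R) := by
  have ⟨σ⟩ : Nonempty (κ ⊕ κ ≃ κ) := by
    rw [← Cardinal.eq]; simp
  have ⟨τ⟩ : Nonempty (Option κ ≃ κ) := by
    rw [← Cardinal.eq]; simp
  obtain ⟨P1, h1⟩ := exists_sp hAW (fun i => G (Sum.inl i))
  obtain ⟨P2, h2⟩ := exists_sp hAW (fun i => G (Sum.inr (Sum.inl i)))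
  obtain ⟨P3, h3⟩ := exists_sp hAW (fun i => G (Sum.inr (Sum.inr i)))
  have h12 : P1 * P2 = 0 := sp_orth h1 h2 (fun i => (hG _).1) fun i j => ho _ _ (by simp)
  have h13 : P1 * P3 = 0 := sp_orth h1 h3 (fun i => (hG _).1) fun i j => ho _ _ (by simp)
  have h23 : P2 * P3 = 0 := sp_orth h2 h3 (fun i => (hG _).1) fun i j => ho _ _ (by simp)
  have hs23 : IsSp (fun i => G (Sum.inr i)) (P2 + P3) := by
    have := sp_sum h2 h3 h23
    convert this using 1
    funext i; rcases i with i | i <;> rfl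
  have h1s : P1 * (P2 + P3) = 0 := by rw [mul_add, h12, h13, add_zero]
  have hSeq : S = P1 + (P2 + P3) := by
    refine sp_unique hS ?_
    have := sp_sum h1 hs23 h1s
    convert this using 1
    funext i; rcases i with i | i <;> rfl
  have P1S : P1 * S = P1 := sp_le_of h1 fun i => sp_le hS _
  have P2S : P2 * S = P2 := sp_le_of h2 fun i => sp_le hS _
  have P3S : P3 * S = P3 := sp_le_of h3 fun i => sp_le hS _
  have P1R : P1 * R = 0 := by rw [← P1S, mul_assoc, hSR, mul_zero]
  have P2R : P2 * R = 0 := by rw [← P2S, mul_assoc, hSR, mul_zero]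
  have P3R : P3 * R = 0 := by rw [← P3S, mul_assoc, hSR, mul_zero]
  have RP1 := orth_symm h1.1 hR P1R
  have P31 := orth_symm h1.1 h3.1 h13
  have e12 : ProjEquiv P1 P2 := orth_add hAW (fun i => hG _) h1 h2
    (fun i j hij => ho _ _ (by simpa using hij)) (fun i j hij => ho _ _ (by simpa using hij)) h12
    (fun i => he _ _)
  have e13 : ProjEquiv P1 P3 := orth_add hAW (fun i => hG _) h1 h3
    (fun i j hij => ho _ _ (by simpa using hij)) (fun i j hij => ho _ _ (by simpa using hij)) h13
    (fun i => he _ _)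
  have e1s : ProjEquiv P1 (P2 + P3) := orth_add hAW (fun i => hG _) (sp_equiv h1 σ) hs23
    (fun i j hij => ho _ _ (by simpa using hij)) (fun i j hij => ho _ _ (by simpa using hij)) h1s
    (fun i => he _ _)
  have hc := proj_add h3.1 hR P3R
  obtain ⟨y, hy, hyle, hRy⟩ := hsub (Sum.inl (τ none))
  unfold ProjLE at hyle
  have RG : ∀ i, G i * R = 0 := fun i => by
    rw [← sp_le hS i, mul_assoc, hSR, mul_zero]
  have yG : ∀ i, y * G (Sum.inl (τ (some i))) = 0 := fun i => by
    rw [← hyle, mul_assoc, ho _ _ (by simp), mul_zero]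
  obtain ⟨Y, hY⟩ := exists_sp hAW
    (fun o : Option κ => o.elim y (fun i => G (Sum.inl (τ (some i)))))
  have YP : Y * P1 = Y := by
    refine sp_le_of hY fun o => ?_
    cases o with
    | none =>
      change y * P1 = y
      rw [← hyle, mul_assoc]; congr 1; exact sp_le h1 _
    | some i => exact sp_le h1 _
  have hcY : ProjEquiv (P3 + R) Y := by
    refine orth_add hAW ?_ (sp_option h3 hR P3R) hY ?_ ?_ ?_ ?_
    · rintro (_ | i)
      · exact hR
      · exact hG _
    · rintro (_ | i) (_ | j) hij
      · exact absurd rfl hij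
      · exact orth_symm (hG _) hR (RG _)
      · exact RG _
      · exact ho _ _ (by simpa using hij)
    · rintro (_ | i) (_ | j) hij
      · exact absurd rfl hij
      · exact yG _
      · exact orth_symm hy (hG _) (yG _)
      · exact ho _ _ (by simpa using hij)
    · rw [← le_symm' hY.1 h1.1 YP, ← mul_assoc, add_mul, P31, RP1, add_zero, zero_mul]
    · rintro (_ | i)
      · exact hRy
      · exact he _ _
  have hc3 : ProjEquiv (P3 + R) P3 := by
    refine schroeder hAW hc h3.1 (by rw [mul_add, h3.1.2, P3R, add_zero]) ?_
    exact pse_trans hc h1.1 ⟨Y, hY.1, YP, hcY⟩ ⟨P3, h3.1, h3.1.2, e13⟩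
  have h2c : P2 * (P3 + R) = 0 := by rw [mul_add, h23, P2R, add_zero]
  refine ⟨P1, P2, P3 + R, h1.1, h2.1, hc, h12, by rw [mul_add, h13, P1R, add_zero], h2c,
    by rw [hSeq]; abel, e12, ?_, ?_⟩
  · exact pe_trans h2.1 (pe_symm e12) (pe_trans h1.1 e13 (pe_symm hc3))
  · exact pe_trans h1.1 e1s (pe_add h2.1 h3.1 h23 h2c (pe_refl h2.1) (pe_symm hc3))

lemma glue (hAW : IsAWStarRing A) {κ : Type u} {h : κ → A} (hh : ∀ k, IsCentralProj (h k))
    (ho : PairwiseOrthogonal h) {e : A}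
    (hsup : IsSp (fun k => h k * e) e) (hP : ∀ k, PP (h k * e)) : PP e := by
  choose a b c ha hb hc hab hac hbc hs eab ebc eabc using hP
  have hle : ∀ k x, x * (h k * e) = x → x * h k = x := fun k x hx => by
    have h1 : h k * e * h k = h k * e := by
      rw [mul_assoc, ← (hh k).2, ← mul_assoc, (hh k).1.2]
    rw [← hx, mul_assoc, h1]
  have hba := fun k => orth_symm (ha k) (hb k) (hab k)
  have hca := fun k => orth_symm (ha k) (hc k) (hac k)
  have hcb := fun k => orth_symm (hb k) (hc k) (hbc k)
  have a_h : ∀ k, a k * h k = a k := fun k => hle k _ (by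
    rw [← hs, mul_add, mul_add, (ha k).2, hab, hac]; simp)
  have b_h : ∀ k, b k * h k = b k := fun k => hle k _ (by
    rw [← hs, mul_add, mul_add, (hb k).2, hba, hbc]; simp)
  have c_h : ∀ k, c k * h k = c k := fun k => hle k _ (by
    rw [← hs, mul_add, mul_add, (hc k).2, hca, hcb]; simp)
  have hxy : ∀ k j x y, k ≠ j → x * h k = x → y * h j = y → x * y = 0 := fun k j x y hkj hx hy => by
    rw [← hx, ← hy, ← (hh j).2, mul_assoc, ← mul_assoc (h k), ho k j hkj, zero_mul, mul_zero]
  obtain ⟨P, hP⟩ := exists_sp hAW a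
  obtain ⟨Q, hQ⟩ := exists_sp hAW b
  obtain ⟨R, hR⟩ := exists_sp hAW c
  have PQ : P * Q = 0 := sp_orth hP hQ (fun k => (hb k).1) fun i j => by
    by_cases hij : i = j
    · subst hij; exact hab i
    · exact hxy _ _ _ _ hij (a_h i) (b_h j)
  have PR : P * R = 0 := sp_orth hP hR (fun k => (hc k).1) fun i j => by
    by_cases hij : i = j
    · subst hij; exact hac i
    · exact hxy _ _ _ _ hij (a_h i) (c_h j)
  have QR : Q * R = 0 := sp_orth hQ hR (fun k => (hc k).1) fun i j => by
    by_cases hij : i = j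
    · subst hij; exact hbc i
    · exact hxy _ _ _ _ hij (b_h i) (c_h j)
  have ao : PairwiseOrthogonal a := fun i j hij => hxy _ _ _ _ hij (a_h i) (a_h j)
  have bo : PairwiseOrthogonal b := fun i j hij => hxy _ _ _ _ hij (b_h i) (b_h j)
  have co : PairwiseOrthogonal c := fun i j hij => hxy _ _ _ _ hij (c_h i) (c_h j)
  have hQR := sp_add hQ hR hb hc QR hbc
  have P_QR : P * (Q + R) = 0 := by rw [mul_add, PQ, PR, add_zero]
  have hPQR := sp_add hP hQR ha (fun i => proj_add (hb i) (hc i) (hbc i)) P_QR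
    (fun i => by rw [mul_add, hab, hac, add_zero])
  have heq : P + (Q + R) = e := by
    refine sp_unique hPQR ?_
    convert hsup using 2 with k
    rw [← hs, add_assoc]
  refine ⟨P, Q, R, hP.1, hQ.1, hR.1, PQ, PR, QR, by rw [add_assoc, heq], ?_, ?_, ?_⟩
  · exact orth_add hAW ha hP hQ ao bo PQ eab
  · exact orth_add hAW hb hQ hR bo co QR ebc
  · refine orth_add hAW ha hP hQR ao ?_ P_QR eabc
    intro i j hij
    refine hxy i j _ _ hij ?_ ?_
    · rw [add_mul, b_h, c_h]
    · rw [add_mul, b_h, c_h]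

lemma PP_split {e : A} (h : PP e) : ∃ e₁ e₂ : A, IsProjection e₁ ∧ IsProjection e₂ ∧ e₁ * e₂ = 0 ∧
        ProjEquiv e₁ e ∧ ProjEquiv e₂ e ∧ e₁ + e₂ = e := by
  obtain ⟨a, b, c, ha, hb, hc, hab, hac, hbc, rfl, eab, ebc, eabc⟩ := h
  have hbc' := proj_add hb hc hbc
  have h1 : ProjEquiv (b + c) b := pe_trans hbc' (pe_symm eabc) eab
  have habc : a * (b + c) = 0 := by rw [mul_add, hab, hac, add_zero]
  have h2 : ProjEquiv (a + (b + c)) (a + b) := pe_add ha hbc' habc hab (pe_refl ha) h1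
  have h3 : ProjEquiv (a + b) (b + c) := pe_add ha hb hab hbc eab ebc
  have hall := proj_add ha hbc' habc
  have h4 : ProjEquiv (a + (b + c)) (b + c) := pe_trans hall h2 h3
  have h5 : ProjEquiv (a + (b + c)) a := pe_trans hall h4 (pe_symm eabc)
  rw [add_assoc]
  exact ⟨a, b + c, ha, hbc', habc, pe_symm h5, pe_symm h4, rfl⟩

lemma a_to_b (hAW : IsAWStarRing A) {e : A} (he : IsProjection e) (h : ∃ e₁ e₂ : A, IsProjection e₁ ∧ IsProjection e₂ ∧ e₁ * e₂ = 0 ∧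
        ProjEquiv e₁ e ∧ ProjEquiv e₂ e ∧ e₁ + e₂ = e) :
    ∃ (ι : Type u) (p : ι → A), Infinite ι ∧ (∀ i, IsProjection (p i)) ∧
        PairwiseOrthogonal p ∧ (∀ i, ProjEquiv (p i) e) ∧ IsSupProj p e := by
  obtain ⟨e₁, e₂, h1, h2, h12, q1, q2, hs⟩ := h
  have h21 := orth_symm h1 h2 h12
  have h1e : e₁ * e = e₁ := by rw [← hs, mul_add, h1.2, h12, add_zero]
  have h2e : e₂ * e = e₂ := by rw [← hs, mul_add, h2.2, h21, zero_add]
  obtain ⟨v, a1, a2⟩ := pe_symm q1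
  obtain ⟨k1, k2⟩ := dn_spec he a1 a2 h1e h2 h2e h21
  obtain ⟨s, hsp⟩ := exists_sp hAW (dn v e₂)
  have hse : s * e = s := sp_le_of hsp fun n => (k1 n).2.1
  have hr := proj_sub he hsp.1 hse
  have dr : ∀ n, dn v e₂ n * (e - s) = 0 := fun n => by
    rw [mul_sub, (k1 n).2.1, sp_le hsp, sub_self]
  have rd := fun n => orth_symm (k1 n).1 hr (dr n)
  have er : e₂ * (e - s) = 0 := dr 0
  have hre : (e - s) * e = e - s := by rw [sub_mul, he.2, hse]
  have hq := proj_add h2 hr er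
  have hqe : (e₂ + (e - s)) * e = e₂ + (e - s) := by rw [add_mul, h2e, hre]
  have hq2 : ProjEquiv (e₂ + (e - s)) e₂ :=
    schroeder hAW hq h2 (by rw [mul_add, h2.2, er, add_zero]) (pe_sub hq he hqe (pe_symm q2))
  let p : ℕ → A := fun n => match n with
    | 0 => e₂ + (e - s)
    | n + 1 => dn v e₂ (n + 1)
  have hp : ∀ n, IsProjection (p n) := by
    rintro (_ | n)
    · exact hq
    · exact (k1 _).1
  have h0 : ∀ n, p 0 * p (n + 1) = 0 := fun n => by
    change (e₂ + (e - s)) * dn v e₂ (n + 1) = 0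
    rw [add_mul, rd, add_zero]
    exact k2 0 (n + 1) (by omega)
  have hpo : ∀ i j, i ≠ j → p i * p j = 0 := by
    rintro (_ | i) (_ | j) hij
    · exact absurd rfl hij
    · exact h0 j
    · exact orth_symm (hp 0) (hp (i + 1)) (h0 i)
    · exact k2 _ _ hij
  refine ⟨ULift ℕ, fun n => p n.down, inferInstance, fun n => hp _, ?_, ?_, he, ?_, ?_⟩
  · intro i j hij
    exact hpo _ _ fun h => hij (ULift.ext _ _ h)
  · rintro ⟨_ | n⟩
    · exact pe_trans hq hq2 q2
    · exact pe_trans (k1 _).1 (pe_symm (k1 (n + 1)).2.2) q2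
  · rintro ⟨_ | n⟩
    · exact hqe
    · exact (k1 _).2.1
  · intro t ht hpt
    have t0 : (e₂ + (e - s)) * t = e₂ + (e - s) := hpt ⟨0⟩
    have t1 : e₂ * t = e₂ := by
      have := congrArg (e₂ * ·) t0
      simp only [← mul_assoc, mul_add e₂, h2.2, er, add_zero] at this
      exact this
    have t2 : (e - s) * t = e - s := by
      rw [add_mul, t1] at t0
      exact add_left_cancel t0
    have t3 : s * t = s := by
      refine sp_le_of hsp ?_
      rintro (_ | n)
      · exact t1
      · exact hpt ⟨n + 1⟩
    unfold ProjLE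
    rw [sub_mul, t3] at t2
    exact sub_left_injective t2

lemma b_to_c {e : A} (h : ∃ (ι : Type u) (p : ι → A), Infinite ι ∧ (∀ i, IsProjection (p i)) ∧
        PairwiseOrthogonal p ∧ (∀ i, ProjEquiv (p i) e) ∧ IsSupProj p e) (z : A)
    (hz : IsCentralProj z) : z * e = 0 ∨ ¬ ProjFinite (z * e) := by
  obtain ⟨ι, p, hi, hp, ho, hpe, hs⟩ := h
  by_contra! hcon
  obtain ⟨hne, hfin⟩ := hcon
  have key : ∀ i, z * p i = z * e := fun i => by
    refine hfin _ (central_mul_proj hz (hp i)) (pe_central hz (pe_symm (hpe i))) ?_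
    have := hs.2.1 i
    unfold ProjLE at *
    rw [mul_assoc, ← mul_assoc (p i), ← hz.2, mul_assoc, this, ← mul_assoc, hz.1.2]
  obtain ⟨i, j, hij⟩ := exists_pair_ne ι
  apply hne
  have h1 := (central_mul_proj hz hs.1).2
  nth_rw 1 [← key i] at h1
  rw [← key j, mul_assoc, ← mul_assoc (p i), ← hz.2 (p i), mul_assoc z, ho i j hij, mul_zero, mul_zero] at h1
  rw [← key j, ← h1]

end Aux4

section Aux5
variable {A : Type u} [NormedRing A] [StarRing A] [CStarRing A] [NormedAlgebra ℂ A]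
  [StarModule ℂ A] [CompleteSpace A]

lemma local_PP (hAW : IsAWStarRing A) {e : A} (he : IsProjection e) (hinf : ¬ ProjFinite e) :
    ∃ h : A, IsCentralProj h ∧ h * e ≠ 0 ∧ PP (h * e) := by
  unfold ProjFinite at hinf
  push Not at hinf
  obtain ⟨f, hf, ⟨v, a1, a2⟩, hfe, hne⟩ := hinf
  unfold ProjLE at hfe
  have hd := proj_sub he hf hfe
  have hd0 : e - f ≠ 0 := fun h => hne (sub_eq_zero.1 h).symm
  have hde : (e - f) * e = e - f := by rw [sub_mul, he.2, hfe]
  have hdf : (e - f) * f = 0 := by rw [sub_mul, hf.2, le_symm' hf he hfe, sub_self]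
  obtain ⟨k1, k2⟩ := dn_spec he a1 a2 hfe hd hde hdf
  set d := e - f with hdd
  obtain ⟨T, hT0, hT, hTo, hTm⟩ := zorn_fam (fun x y : A => x * y = 0)
    (fun x => IsProjection x ∧ x * e = x ∧ ProjEquiv d x) (Set.range (dn v d))
    (by rintro _ ⟨n, rfl⟩; exact k1 n)
    (by rintro _ ⟨n, rfl⟩ _ ⟨m, rfl⟩ hnm; exact k2 _ _ fun h => hnm (by rw [h]))
  have hdT : d ∈ T := hT0 ⟨0, rfl⟩
  have hTinf : Infinite T := by
    rw [Set.infinite_coe_iff]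
    refine (Set.infinite_range_of_injective ?_).mono hT0
    intro n m hnm
    by_contra hne
    have h1 := k2 n m hne
    rw [hnm, (k1 m).1.2] at h1
    have h2 := (k1 m).2.2
    rw [h1] at h2
    exact hd0 (pe_zero h2)
  obtain ⟨S, hS⟩ := exists_sp hAW (fun x : T => (x : A))
  have Se : S * e = S := sp_le_of hS fun x => (hT x x.2).2.1
  have hr := proj_sub he hS.1 Se
  have hTr : ∀ x ∈ T, x * (e - S) = 0 := fun x hx => by
    rw [mul_sub, (hT x hx).2.1, sp_le hS ⟨x, hx⟩, sub_self]
  have hSr : S * (e - S) = 0 := by rw [mul_sub, Se, hS.1.2, sub_self]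
  have hre : (e - S) * e = e - S := by rw [sub_mul, he.2, Se]
  obtain ⟨h, hh, g1, g2⟩ := gc hAW hr hd (orth_symm hd hr (hTr d hdT))
  have hhd : h * d ≠ 0 := by
    intro h0
    rw [sub_mul, h0, one_mul, sub_zero] at g2
    obtain ⟨x, hx, hxr, hdx⟩ := g2
    unfold ProjLE at hxr
    have hxr' : x * (e - S) = x := by
      rw [← hxr, mul_assoc, mul_assoc, hr.2]
    have hSx : ∀ y ∈ T, x * y = 0 := fun y hy => by
      rw [← hxr', mul_assoc, orth_symm (hT y hy).1 hr (hTr y hy), mul_zero]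
    have hxT : x ∈ T := by
      refine hTm x ⟨hx, ?_, hdx⟩ fun y hy => ⟨hSx y hy, orth_symm hx (hT y hy).1 (hSx y hy)⟩
      rw [← hxr', mul_assoc, hre]
    have := hTr x hxT
    rw [hxr'] at this
    rw [this] at hdx
    exact hd0 (pe_zero hdx)
  have hed : e * d = d := le_symm' hd he hde
  refine ⟨h, hh, fun h0 => hhd (by rw [← hed, ← mul_assoc, h0, zero_mul]), ?_⟩
  have ⟨φ⟩ : Nonempty (T ⊕ (T ⊕ T) ≃ T) := by
    rw [← Cardinal.eq]; simp
  have hdec : h * e = h * S + h * (e - S) := by rw [← mul_add]; congr 1; abel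
  rw [hdec]
  have hxy : ∀ x y : A, h * x * (h * y) = h * (x * y) := fun x y => by
    rw [mul_assoc, ← mul_assoc x, ← hh.2 x, mul_assoc h x, ← mul_assoc, hh.1.2]
  refine block hAW (G := fun i => h * (φ i : A)) (fun i => central_mul_proj hh (hT _ (φ i).2).1)
    ?_ (sp_equiv (sp_central hS hh) φ) ?_ (central_mul_proj hh hr) ?_ ?_
  · intro i j hij
    have := hTo _ (φ i).2 _ (φ j).2 fun h' => hij (φ.injective (Subtype.ext h'))
    rw [hxy, this, mul_zero]
  · intro i j
    exact pe_central hh (pe_trans (hT _ (φ i).2).1 (pe_symm (hT _ (φ i).2).2.2) (hT _ (φ j).2).2.2)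
  · rw [hxy, hSr, mul_zero]
  · intro i
    have hi := central_mul_proj hh (hT _ (φ i).2).1
    exact pse_trans (central_mul_proj hh hr) (central_mul_proj hh hd) g1
      ⟨_, hi, hi.2, pe_central hh (hT _ (φ i).2).2.2⟩

lemma c_to_a (hAW : IsAWStarRing A) {e : A} (he : IsProjection e)
    (hc : ∀ z : A, IsCentralProj z → z * e = 0 ∨ ¬ ProjFinite (z * e)) : PP e := by
  obtain ⟨T, -, hT, hTo, hTm⟩ := zorn_fam (fun x y : A => x * y = 0)
    (fun x => IsCentralProj x ∧ x * e ≠ 0 ∧ PP (x * e)) ∅ (by simp) (by simp)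
  obtain ⟨Z, hZ⟩ := exists_sp hAW (fun x : T => (x : A))
  have hZc : IsCentralProj Z := by
    refine central_of hZ.1 fun a => ?_
    rw [mul_assoc]
    refine (hZ.2 _).1 fun x => ?_
    rw [← mul_assoc, (hT x x.2).1.2, mul_assoc, mul_sub, mul_one, sp_le hZ x, sub_self, mul_zero]
  have hcz := central_compl hZc
  have hZe : (1 - Z) * e = 0 := by
    by_contra hne
    have hinf := (hc _ hcz).resolve_left hne
    obtain ⟨h, hh, h0, hP⟩ := local_PP hAW (central_mul_proj hcz he) hinf
    rw [← mul_assoc] at h0 hP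
    have hhc := central_mul hh hcz
    have hx : ∀ x ∈ T, h * (1 - Z) * x = 0 := fun x hx => by
      rw [mul_assoc, hcz.2, mul_sub, mul_one, sp_le hZ ⟨x, hx⟩, sub_self, mul_zero]
    have hmem : h * (1 - Z) ∈ T := hTm _ ⟨hhc, h0, hP⟩ fun y hy =>
      ⟨hx y hy, by rw [← hhc.2, hx y hy]⟩
    have := hx _ hmem
    rw [hhc.1.2] at this
    rw [this, zero_mul] at h0
    exact h0 rfl
  have hZe' : Z * e = e := by
    rw [sub_mul, one_mul, sub_eq_zero] at hZe; exact hZe.symm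
  refine glue hAW (h := fun x : T => (x : A)) (fun x => (hT x x.2).1)
    (fun x y hxy => hTo x x.2 y y.2 fun h => hxy (Subtype.ext h)) ⟨he, fun y => ?_⟩
    (fun x => (hT x x.2).2.2)
  simp only [mul_assoc]
  rw [hZ.2, ← mul_assoc, hZe']

end Aux5

/-- Characterizations of properly infinite projections in an AW*-algebra. -/
theorem properlyInfinite_tfae {A : Type u} [NormedRing A] [StarRing A] [CStarRing A]
    [NormedAlgebra ℂ A] [StarModule ℂ A] [CompleteSpace A]
    (hAW : IsAWStarRing A) (e : A) (he : IsProjection e) (hne : e ≠ 0) :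
    ((∃ e₁ e₂ : A, IsProjection e₁ ∧ IsProjection e₂ ∧ e₁ * e₂ = 0 ∧
        ProjEquiv e₁ e ∧ ProjEquiv e₂ e ∧ e₁ + e₂ = e) ↔
      (∃ (ι : Type u) (p : ι → A), Infinite ι ∧ (∀ i, IsProjection (p i)) ∧
        PairwiseOrthogonal p ∧ (∀ i, ProjEquiv (p i) e) ∧ IsSupProj p e)) ∧
    ((∃ (ι : Type u) (p : ι → A), Infinite ι ∧ (∀ i, IsProjection (p i)) ∧
        PairwiseOrthogonal p ∧ (∀ i, ProjEquiv (p i) e) ∧ IsSupProj p e) ↔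
      (∀ z : A, IsCentralProj z → z * e = 0 ∨ ¬ ProjFinite (z * e))) := by
  have ab := a_to_b hAW he
  have bc : (∃ (ι : Type u) (p : ι → A), Infinite ι ∧ (∀ i, IsProjection (p i)) ∧
        PairwiseOrthogonal p ∧ (∀ i, ProjEquiv (p i) e) ∧ IsSupProj p e) →
      (∀ z : A, IsCentralProj z → z * e = 0 ∨ ¬ ProjFinite (z * e)) := b_to_c
  have ca := fun h => PP_split (c_to_a hAW he h)
  exact ⟨⟨ab, fun h => ca (bc h)⟩, bc, fun h => ab (ca h)⟩
end
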